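/- arXiv:2501.10043 — 2 statements merged into one kernel-verified Lean document; each statement's English description precedes it below -/
import Mathlib

section
/- (Proposition 2.2, Hilbert function of the determinantal-type ideal.) With F, n, n_1, n_2, Z', I as in the context, for every k ∈ ℕ one has dim_F(Z'_k / (I ∩ Z'_k)) = P_2(n_2, n−n_1, n_1, n_2−n_1+1, k). -/
/-- A multiset of pairs of positive integers contains a 2-chain:
two elements (at distinct positions) with both coordinates strictly increasing. -/
def Has2Chain (S : Multiset (ℕ × ℕ)) : Prop :=
  ∃ a ∈ S, ∃ b ∈ S, a.1 < b.1 ∧ a.2 < b.2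

/-- A multiset of pairs contains a 3-chain:
three elements with both coordinates strictly increasing. -/
def Has3Chain (S : Multiset (ℕ × ℕ)) : Prop :=
  ∃ a ∈ S, ∃ b ∈ S, ∃ c ∈ S, a.1 < b.1 ∧ b.1 < c.1 ∧ a.2 < b.2 ∧ b.2 < c.2

/-- The index multiset of a degree-`r` monomial in the variables `z_{i,j}`,
`1 ≤ i ≤ m`, `1 ≤ j ≤ n`, with 1-indexed entries. -/
def idxMS (m n r : ℕ) (f : Sym (Fin m × Fin n) r) : Multiset (ℕ × ℕ) :=
  Multiset.map (fun p => (p.1.1 + 1, p.2.1 + 1)) (f : Multiset (Fin m × Fin n))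

/-- `P1 m n ξ r`: number of degree-`r` monomials in the `m × n` grid of variables
whose index multiset contains no 3-chain and whose part with column index `< ξ`
contains no 2-chain. -/
noncomputable def P1 (m n ξ r : ℕ) : ℕ :=
  Nat.card {f : Sym (Fin m × Fin n) r //
    ¬ Has3Chain (idxMS m n r f) ∧
    ¬ Has2Chain ((idxMS m n r f).filter (fun p => p.2 < ξ)) }

/-- `h3 m n r`: number of degree-`r` monomials whose index multiset contains no 3-chain. -/
noncomputable def h3 (m n r : ℕ) : ℕ :=
  Nat.card {f : Sym (Fin m × Fin n) r // ¬ Has3Chain (idxMS m n r f) }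

/-- `P2 m n ρ ξ r`: number of degree-`r` monomials `f` such that every `(i,j)` in the
index multiset satisfies `i ≤ ρ` or `j ≥ ξ`, the index multiset contains no 3-chain, and
neither the part with `j < ξ` nor the part with `i > ρ` contains a 2-chain. -/
noncomputable def P2 (m n ρ ξ r : ℕ) : ℕ :=
  Nat.card {f : Sym (Fin m × Fin n) r //
    (∀ p ∈ idxMS m n r f, p.1 ≤ ρ ∨ ξ ≤ p.2) ∧
    ¬ Has3Chain (idxMS m n r f) ∧
    ¬ Has2Chain ((idxMS m n r f).filter (fun p => p.2 < ξ)) ∧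
    ¬ Has2Chain ((idxMS m n r f).filter (fun p => ρ < p.1)) }
open MvPolynomial in
/-- The ideal `I` of `F[z_{i,j} : 1 ≤ i ≤ n-n₁, 1 ≤ j ≤ n₂]` generated by
(a) the variables `z_{i,j}` with `1 ≤ i ≤ n₂-n₁`, `n₁+1 ≤ j ≤ n₂`;
(b) the 2×2 minors with rows in `[1, n₂-n₁]` and columns in `[1, n₁]`;
(c) the 2×2 minors with rows in `[n₂-n₁+1, n-n₁]` and columns in `[n₁+1, n₂]`;
(d) all 3×3 minors.  (Indices of `Fin` are 0-based, so `i : Fin (n-n₁)` represents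
the row `i+1`, and similarly for columns.) -/
noncomputable def detIdeal (F : Type*) [Field F] (n n₁ n₂ : ℕ) :
    Ideal (MvPolynomial (Fin (n - n₁) × Fin n₂) F) :=
  Ideal.span
    ({ p | ∃ i : Fin (n - n₁), ∃ j : Fin n₂,
        (i : ℕ) < n₂ - n₁ ∧ n₁ ≤ (j : ℕ) ∧ p = X (i, j) } ∪
     { p | ∃ i i' : Fin (n - n₁), ∃ j j' : Fin n₂,
        i < i' ∧ (i' : ℕ) < n₂ - n₁ ∧ j < j' ∧ (j' : ℕ) < n₁ ∧
        p = X (i, j) * X (i', j') - X (i, j') * X (i', j) } ∪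
     { p | ∃ i i' : Fin (n - n₁), ∃ j j' : Fin n₂,
        n₂ - n₁ ≤ (i : ℕ) ∧ i < i' ∧ n₁ ≤ (j : ℕ) ∧ j < j' ∧
        p = X (i, j) * X (i', j') - X (i, j') * X (i', j) } ∪
     { p | ∃ i₁ i₂ i₃ : Fin (n - n₁), ∃ j₁ j₂ j₃ : Fin n₂,
        i₁ < i₂ ∧ i₂ < i₃ ∧ j₁ < j₂ ∧ j₂ < j₃ ∧
        p = X (i₁, j₁) * X (i₂, j₂) * X (i₃, j₃)
            + X (i₂, j₁) * X (i₃, j₂) * X (i₁, j₃)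
            + X (i₃, j₁) * X (i₁, j₂) * X (i₂, j₃)
            - X (i₂, j₁) * X (i₁, j₂) * X (i₃, j₃)
            - X (i₁, j₁) * X (i₃, j₂) * X (i₂, j₃)
            - X (i₃, j₁) * X (i₂, j₂) * X (i₁, j₃) })

/-- `hilbFn F n n₁ n₂ k` is `dim_F (Z'_k / (I ∩ Z'_k))`, the Hilbert function of the
homogeneous coordinate ring of the variety determined by `detIdeal F n n₁ n₂`. -/
noncomputable def hilbFn (F : Type*) [Field F] (n n₁ n₂ k : ℕ) : ℕ :=
  Module.finrank F
    ((MvPolynomial.homogeneousSubmodule (Fin (n - n₁) × Fin n₂) F k) ⧸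
      (Submodule.comap
        (MvPolynomial.homogeneousSubmodule (Fin (n - n₁) × Fin n₂) F k).subtype
        (Submodule.restrictScalars F (detIdeal F n n₁ n₂))))

section StandardMonomials

open MvPolynomial

/-- A family of vectors is linearly independent if it is triangular, with nonzero diagonal,
with respect to a family of functionals and a weight. -/
theorem linearIndependent_of_triangular {ι K V : Type*} [Field K] [AddCommGroup V] [Module K V]
    (v : ι → V) (c : ι → V →ₗ[K] K) (w : ι → ℕ) (hdiag : ∀ f, c f (v f) ≠ 0)
    (htri : ∀ f g, c f (v g) ≠ 0 → f = g ∨ w f < w g) : LinearIndependent K v := by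
  rw [linearIndependent_iff]
  intro l hl
  by_contra hne
  obtain ⟨f, hf, hmax⟩ := l.support.exists_max_image w (Finsupp.support_nonempty_iff.2 hne)
  have h0 := congrArg (c f) hl
  rw [Finsupp.linearCombination_apply, Finsupp.sum, map_sum, map_zero,
    Finset.sum_eq_single_of_mem f hf] at h0
  · rw [map_smul, smul_eq_mul] at h0
    exact (mul_ne_zero (Finsupp.mem_support_iff.1 hf) (hdiag f)) h0
  · intro g hg hgf
    rw [map_smul, smul_eq_mul]
    by_contra hc
    rcases htri f g (right_ne_zero_of_mul hc) with h | h
    · exact hgf h.symm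
    · exact absurd (hmax g hg) (not_le.2 h)

/-- The weight `∑ i * j` of a multiset of index pairs. -/
def pairWeight (s : Multiset (ℕ × ℕ)) : ℕ := (s.map fun a => a.1 * a.2).sum

theorem pairWeight_add (s t : Multiset (ℕ × ℕ)) :
    pairWeight (s + t) = pairWeight s + pairWeight t := by
  simp [pairWeight]

theorem Has2Chain.mono {s t : Multiset (ℕ × ℕ)} (h : s ≤ t) (hs : Has2Chain s) : Has2Chain t := by
  obtain ⟨a, ha, b, hb, hab⟩ := hs
  exact ⟨a, Multiset.mem_of_le h ha, b, Multiset.mem_of_le h hb, hab⟩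

/-- A nonempty multiset without 2-chains contains its north-east corner. -/
theorem corner_mem_of_not_has2Chain {s : Multiset (ℕ × ℕ)} (hs : ¬ Has2Chain s) {i j : ℕ}
    (hi : i ∈ s.map Prod.fst) (hj : j ∈ s.map Prod.snd) (hmin : ∀ k ∈ s.map Prod.fst, i ≤ k)
    (hmax : ∀ k ∈ s.map Prod.snd, k ≤ j) : (i, j) ∈ s := by
  obtain ⟨⟨i, j'⟩, ha, rfl⟩ := Multiset.mem_map.1 hi
  obtain ⟨⟨i', j⟩, hb, rfl⟩ := Multiset.mem_map.1 hj
  have h1 : i ≤ i' := hmin _ (Multiset.mem_map_of_mem Prod.fst hb)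
  have h2 : j' ≤ j := hmax _ (Multiset.mem_map_of_mem Prod.snd ha)
  rcases h1.eq_or_lt with h1 | h1
  · subst h1; exact hb
  rcases h2.eq_or_lt with h2 | h2
  · subst h2; exact ha
  exact absurd ⟨_, ha, _, hb, h1, h2⟩ hs

/-- A multiset without 2-chains is determined by its two margins. -/
theorem eq_of_not_has2Chain_of_margins {s t : Multiset (ℕ × ℕ)} (hs : ¬ Has2Chain s)
    (ht : ¬ Has2Chain t) (h1 : s.map Prod.fst = t.map Prod.fst)
    (h2 : s.map Prod.snd = t.map Prod.snd) : s = t := by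
  induction hn : Multiset.card s generalizing s t with
  | zero =>
    have hc : Multiset.card s = Multiset.card t := by simpa using congrArg Multiset.card h1
    rw [Multiset.card_eq_zero.1 hn, Multiset.card_eq_zero.1 (hc.symm.trans hn)]
  | succ n ih =>
    have hs0 : s ≠ 0 := by rintro rfl; simp at hn
    obtain ⟨a, ha⟩ := Multiset.exists_mem_of_ne_zero hs0
    obtain ⟨i, hi, hmin⟩ := (s.map Prod.fst).toFinset.exists_min_image id
      ⟨a.1, by simpa using ⟨a.2, ha⟩⟩
    obtain ⟨j, hj, hmax⟩ := (s.map Prod.snd).toFinset.exists_max_image id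
      ⟨a.2, by simpa using ⟨a.1, ha⟩⟩
    simp only [Multiset.mem_toFinset, id] at hi hmin hj hmax
    obtain ⟨s', rfl⟩ := Multiset.exists_cons_of_mem (corner_mem_of_not_has2Chain hs hi hj hmin hmax)
    rw [h1] at hi hmin
    rw [h2] at hj hmax
    obtain ⟨t', rfl⟩ := Multiset.exists_cons_of_mem (corner_mem_of_not_has2Chain ht hi hj hmin hmax)
    rw [ih (fun h => hs (h.mono (Multiset.le_cons_self _ _)))
      (fun h => ht (h.mono (Multiset.le_cons_self _ _))) (by simpa using h1) (by simpa using h2)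
      (by simpa using hn)]

theorem exists_cons_cons_of_mem {α : Type*} {s : Multiset α} {a b : α} (ha : a ∈ s) (hb : b ∈ s)
    (hab : a ≠ b) : ∃ r, s = a ::ₘ b ::ₘ r := by
  obtain ⟨s, rfl⟩ := Multiset.exists_cons_of_mem ha
  rw [Multiset.mem_cons] at hb
  obtain ⟨r, rfl⟩ := Multiset.exists_cons_of_mem (hb.resolve_left hab.symm)
  exact ⟨r, rfl⟩

theorem exists_cons_cons_cons_of_mem {α : Type*} {s : Multiset α} {a b c : α} (ha : a ∈ s)
    (hb : b ∈ s) (hc : c ∈ s) (hab : a ≠ b) (hac : a ≠ c) (hbc : b ≠ c) :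
    ∃ r, s = a ::ₘ b ::ₘ c ::ₘ r := by
  obtain ⟨r, rfl⟩ := exists_cons_cons_of_mem ha hb hab
  simp only [Multiset.mem_cons] at hc
  obtain ⟨r, rfl⟩ := Multiset.exists_cons_of_mem ((hc.resolve_left hac.symm).resolve_left hbc.symm)
  exact ⟨r, rfl⟩

/-- Among multisets with prescribed margins, the one without 2-chains is the unique minimizer
of the weight. -/
theorem eq_or_pairWeight_lt {s t : Multiset (ℕ × ℕ)} (hs : ¬ Has2Chain s)
    (h1 : s.map Prod.fst = t.map Prod.fst) (h2 : s.map Prod.snd = t.map Prod.snd) :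
    s = t ∨ pairWeight s < pairWeight t := by
  induction hn : pairWeight t using Nat.strong_induction_on generalizing t with
  | _ n ih =>
    by_cases ht : Has2Chain t
    · right
      obtain ⟨⟨i, j⟩, ha, ⟨i', j'⟩, hb, hi, hj⟩ := ht
      obtain ⟨r, rfl⟩ := exists_cons_cons_of_mem ha hb (by rintro h; simp_all)
      have hlt : pairWeight ((i, j') ::ₘ (i', j) ::ₘ r) < n := by
        simp only [pairWeight, Multiset.map_cons, Multiset.sum_cons] at hn ⊢
        dsimp only at hi hj
        nlinarith
      rcases ih _ hlt (t := (i, j') ::ₘ (i', j) ::ₘ r) (by simpa using h1)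
        (by rw [h2]; simp [Multiset.cons_swap]) rfl with h | h
      · rwa [h]
      · exact h.trans hlt
    · exact Or.inl (eq_of_not_has2Chain_of_margins hs ht h1 h2)

/-- A standard multiset splits into two parts without 2-chains, the first one supported on
`i ≤ ρ` and the second one on `ξ ≤ j`. -/
theorem exists_split_of_standard {s : Multiset (ℕ × ℕ)} {ρ ξ : ℕ}
    (h0 : ∀ a ∈ s, a.1 ≤ ρ ∨ ξ ≤ a.2) (h3 : ¬ Has3Chain s)
    (hξ : ¬ Has2Chain (s.filter fun a => a.2 < ξ)) (hρ : ¬ Has2Chain (s.filter fun a => ρ < a.1)) :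
    ∃ s₁ s₂, s₁ + s₂ = s ∧ ¬ Has2Chain s₁ ∧ ¬ Has2Chain s₂ ∧ (∀ a ∈ s₁, a.1 ≤ ρ) ∧
      ∀ a ∈ s₂, ξ ≤ a.2 := by
  classical
  refine ⟨s.filter fun a => a.1 ≤ ρ ∧ ¬ ∃ b ∈ s, b.1 < a.1 ∧ b.2 < a.2,
    s.filter fun a => ¬ (a.1 ≤ ρ ∧ ¬ ∃ b ∈ s, b.1 < a.1 ∧ b.2 < a.2),
    Multiset.filter_add_not _ _, ?_, ?_, ?_, ?_⟩
  · rintro ⟨a, ha, b, hb, hab⟩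
    rw [Multiset.mem_filter] at ha hb
    exact hb.2.2 ⟨a, ha.1, hab⟩
  · rintro ⟨a, ha, b, hb, hab⟩
    rw [Multiset.mem_filter] at ha hb
    by_cases hc : ∃ c ∈ s, c.1 < a.1 ∧ c.2 < a.2
    · obtain ⟨c, hc, hca⟩ := hc
      exact h3 ⟨c, hc, a, ha.1, b, hb.1, hca.1, hab.1, hca.2, hab.2⟩
    · have : ρ < a.1 := by by_contra h; exact ha.2 ⟨not_lt.1 h, hc⟩
      exact hρ ⟨a, Multiset.mem_filter.2 ⟨ha.1, this⟩, b,
        Multiset.mem_filter.2 ⟨hb.1, this.trans hab.1⟩, hab⟩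
  · intro a ha
    exact (Multiset.mem_filter.1 ha).2.1
  · intro a ha
    rw [Multiset.mem_filter] at ha
    by_contra hlt
    rw [not_le] at hlt
    refine ha.2 ⟨(h0 a ha.1).resolve_right (not_le.2 hlt), ?_⟩
    rintro ⟨b, hb, hba⟩
    exact hξ ⟨b, Multiset.mem_filter.2 ⟨hb, hba.2.trans hlt⟩, a,
      Multiset.mem_filter.2 ⟨ha.1, hlt⟩, hba⟩

/-- The index multiset of `∏ x_i y_j` over `s` times `∏ u_i v_j` over `t`, where the second
component of an index tells the four families `x, y, u, v` of variables apart. -/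
def splitMargins (s t : Multiset (ℕ × ℕ)) : Multiset (ℕ × Fin 4) :=
  s.map (fun a => (a.1, 0)) + s.map (fun a => (a.2, 1)) +
    (t.map (fun a => (a.1, 2)) + t.map (fun a => (a.2, 3)))

theorem map_eq_of_splitMargins_eq {s t s' t' : Multiset (ℕ × ℕ)}
    (h : splitMargins s t = splitMargins s' t') :
    s.map Prod.fst = s'.map Prod.fst ∧ s.map Prod.snd = s'.map Prod.snd ∧
      t.map Prod.fst = t'.map Prod.fst ∧ t.map Prod.snd = t'.map Prod.snd := by
  have key : ∀ e : Fin 4, ∀ s t : Multiset (ℕ × ℕ),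
      ((splitMargins s t).filter (fun a => a.2 = e)).map Prod.fst =
        if e = 0 then s.map Prod.fst else if e = 1 then s.map Prod.snd else
          if e = 2 then t.map Prod.fst else t.map Prod.snd := by
    intro e s t
    fin_cases e <;> simp [splitMargins, Multiset.filter_map]
  refine ⟨?_, ?_, ?_, ?_⟩
  · simpa [key] using congrArg (fun u => (u.filter (fun a => a.2 = 0)).map Prod.fst) h
  · simpa [key] using congrArg (fun u => (u.filter (fun a => a.2 = 1)).map Prod.fst) h
  · simpa [key] using congrArg (fun u => (u.filter (fun a => a.2 = 2)).map Prod.fst) h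
  · simpa [key] using congrArg (fun u => (u.filter (fun a => a.2 = 3)).map Prod.fst) h

section Parametrization

variable (F : Type*) [Field F]

/-- The summand `x_i y_j` of the generic matrix, restricted to `i ≤ ρ`. -/
noncomputable def leftTerm (ρ : ℕ) (a : ℕ × ℕ) : MvPolynomial (ℕ × Fin 4) F :=
  (if a.1 ≤ ρ then X (a.1, 0) else 0) * X (a.2, 1)

/-- The summand `u_i v_j` of the generic matrix, restricted to `ξ ≤ j`. -/
noncomputable def rightTerm (ξ : ℕ) (a : ℕ × ℕ) : MvPolynomial (ℕ × Fin 4) F :=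
  X (a.1, 2) * (if ξ ≤ a.2 then X (a.2, 3) else 0)

theorem prod_map_X_eq_monomial {τ : Type*} [DecidableEq τ] (s : Multiset τ) :
    (s.map (X : τ → MvPolynomial τ F)).prod = monomial (Multiset.toFinsupp s) 1 := by
  induction s using Multiset.induction_on with
  | empty => simp
  | cons a s ih =>
    rw [Multiset.map_cons, Multiset.prod_cons, ih, X, monomial_mul, ← Multiset.singleton_add a s,
      map_add, Multiset.toFinsupp_singleton, one_mul]

theorem prod_map_leftTerm (ρ : ℕ) (s : Multiset (ℕ × ℕ)) :
    (s.map (leftTerm F ρ)).prod = if ∀ a ∈ s, a.1 ≤ ρ then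
      (s.map fun a => X (a.1, 0)).prod * (s.map fun a => X (a.2, 1)).prod else 0 := by
  split_ifs with h
  · rw [← Multiset.prod_map_mul]
    refine congrArg _ (Multiset.map_congr rfl fun a ha => ?_)
    rw [leftTerm, if_pos (h a ha)]
  · push Not at h
    obtain ⟨a, ha, h⟩ := h
    refine Multiset.prod_eq_zero (Multiset.mem_map.2 ⟨a, ha, ?_⟩)
    rw [leftTerm, if_neg (not_le.2 h), zero_mul]

theorem prod_map_rightTerm (ξ : ℕ) (s : Multiset (ℕ × ℕ)) :
    (s.map (rightTerm F ξ)).prod = if ∀ a ∈ s, ξ ≤ a.2 then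
      (s.map fun a => X (a.1, 2)).prod * (s.map fun a => X (a.2, 3)).prod else 0 := by
  split_ifs with h
  · rw [← Multiset.prod_map_mul]
    refine congrArg _ (Multiset.map_congr rfl fun a ha => ?_)
    rw [rightTerm, if_pos (h a ha)]
  · push Not at h
    obtain ⟨a, ha, h⟩ := h
    refine Multiset.prod_eq_zero (Multiset.mem_map.2 ⟨a, ha, ?_⟩)
    rw [rightTerm, if_neg (not_le.2 h), mul_zero]

open Classical in
theorem coeff_prod_leftTerm_mul_prod_rightTerm (ρ ξ : ℕ) (s t : Multiset (ℕ × ℕ))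
    (u : Multiset (ℕ × Fin 4)) :
    coeff (Multiset.toFinsupp u) ((s.map (leftTerm F ρ)).prod * (t.map (rightTerm F ξ)).prod) =
      ((if (∀ a ∈ s, a.1 ≤ ρ) ∧ (∀ a ∈ t, ξ ≤ a.2) ∧ splitMargins s t = u then 1 else 0 : ℕ) :
        F) := by
  rw [prod_map_leftTerm, prod_map_rightTerm]
  by_cases hs : ∀ a ∈ s, a.1 ≤ ρ
  swap
  · rw [if_neg hs, if_neg (mt And.left hs)]; simp
  by_cases ht : ∀ a ∈ t, ξ ≤ a.2
  swap
  · rw [if_neg ht, if_neg (mt (And.left ∘ And.right) ht)]; simp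
  have : (s.map fun a => X (a.1, 0)).prod * (s.map fun a => X (a.2, 1)).prod *
      ((t.map fun a => X (a.1, 2)).prod * (t.map fun a => X (a.2, 3)).prod) =
      monomial (Multiset.toFinsupp (splitMargins s t)) (1 : F) := by
    rw [← prod_map_X_eq_monomial]
    simp only [splitMargins, Multiset.map_add, Multiset.prod_add, Multiset.map_map,
      Function.comp_def]
  rw [if_pos hs, if_pos ht, this, coeff_monomial]
  by_cases hu : splitMargins s t = u
  · rw [if_pos (congrArg _ hu), if_pos ⟨hs, ht, hu⟩, Nat.cast_one]
  · rw [if_neg (Multiset.toFinsupp.injective.ne hu), if_neg (mt (And.right ∘ And.right) hu),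
      Nat.cast_zero]

theorem coeff_prod_eq_cast (ρ ξ : ℕ) (s : Multiset (ℕ × ℕ)) (u : Multiset (ℕ × Fin 4)) :
    ∃ N : ℕ, coeff (Multiset.toFinsupp u)
        (s.map fun a => leftTerm F ρ a + rightTerm F ξ a).prod = (N : F) ∧
      (N ≠ 0 ↔ ∃ s₁ s₂, s₁ + s₂ = s ∧ (∀ a ∈ s₁, a.1 ≤ ρ) ∧ (∀ a ∈ s₂, ξ ≤ a.2) ∧
        splitMargins s₁ s₂ = u) := by
  classical
  refine ⟨(s.antidiagonal.map fun p => if (∀ a ∈ p.1, a.1 ≤ ρ) ∧ (∀ a ∈ p.2, ξ ≤ a.2) ∧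
    splitMargins p.1 p.2 = u then 1 else 0).sum, ?_, ?_⟩
  · rw [Multiset.prod_map_add, ← lcoeff_apply (R := F), map_multiset_sum, Multiset.map_map,
      Nat.cast_multiset_sum, Multiset.map_map]
    refine congrArg _ (Multiset.map_congr rfl fun p _ => ?_)
    exact coeff_prod_leftTerm_mul_prod_rightTerm F ρ ξ p.1 p.2 u
  · rw [Ne, Multiset.sum_eq_zero_iff]
    simp only [Multiset.mem_map, Prod.exists, Multiset.mem_antidiagonal, not_forall]
    constructor
    · rintro ⟨x, ⟨s₁, s₂, hs, rfl⟩, hx⟩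
      exact ⟨s₁, s₂, hs, by by_contra h; exact hx (if_neg h)⟩
    · rintro ⟨s₁, s₂, hs, h⟩
      exact ⟨1, ⟨s₁, s₂, hs, if_pos h⟩, one_ne_zero⟩

end Parametrization

/-- Products of entries of the generic matrix `x_i y_j + u_i v_j` over standard index multisets
are linearly independent. -/
theorem linearIndependent_prod_of_standard (F : Type*) [Field F] [CharZero F] (ρ ξ : ℕ) {ι : Type*}
    (S : ι → Multiset (ℕ × ℕ)) (hS : Function.Injective S)
    (h0 : ∀ f, ∀ a ∈ S f, a.1 ≤ ρ ∨ ξ ≤ a.2) (h3 : ∀ f, ¬ Has3Chain (S f))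
    (hξ : ∀ f, ¬ Has2Chain ((S f).filter fun a => a.2 < ξ))
    (hρ : ∀ f, ¬ Has2Chain ((S f).filter fun a => ρ < a.1)) :
    LinearIndependent F fun f =>
      ((S f).map fun a => leftTerm F ρ a + rightTerm F ξ a).prod := by
  choose s₁ s₂ hadd hs₁ hs₂ hl hr using
    fun f => exists_split_of_standard (h0 f) (h3 f) (hξ f) (hρ f)
  refine linearIndependent_of_triangular _
    (fun f => lcoeff F (Multiset.toFinsupp (splitMargins (s₁ f) (s₂ f))))
    (fun f => pairWeight (S f)) ?_ ?_
  · intro f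
    obtain ⟨N, hN, hN'⟩ := coeff_prod_eq_cast F ρ ξ (S f) (splitMargins (s₁ f) (s₂ f))
    rw [lcoeff_apply, hN, Nat.cast_ne_zero, hN']
    exact ⟨_, _, hadd f, hl f, hr f, rfl⟩
  · intro f g h
    obtain ⟨N, hN, hN'⟩ := coeff_prod_eq_cast F ρ ξ (S g) (splitMargins (s₁ f) (s₂ f))
    rw [lcoeff_apply, hN, Nat.cast_ne_zero, hN'] at h
    obtain ⟨t₁, t₂, ht, -, -, hm⟩ := h
    obtain ⟨e1, e2, e3, e4⟩ := map_eq_of_splitMargins_eq hm.symm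
    rw [← hS.eq_iff, ← hadd f, ← ht, pairWeight_add, pairWeight_add]
    rcases eq_or_pairWeight_lt (hs₁ f) e1 e2 with h | h <;>
      rcases eq_or_pairWeight_lt (hs₂ f) e3 e4 with h' | h'
    · exact Or.inl (by rw [h, h'])
    · right; rw [h]; omega
    · right; rw [h']; omega
    · right; omega

/-- The shifted index multiset of a multiset of cells. -/
def shiftedIndices {m N : ℕ} (s : Multiset (Fin m × Fin N)) : Multiset (ℕ × ℕ) :=
  s.map fun p => (p.1.1 + 1, p.2.1 + 1)

theorem shiftedIndices_injective (m N : ℕ) :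
    Function.Injective (shiftedIndices : Multiset (Fin m × Fin N) → Multiset (ℕ × ℕ)) := by
  refine Multiset.map_injective fun a b h => ?_
  simpa [Prod.ext_iff, Fin.ext_iff] using h

/-- The standardness condition on index multisets. -/
def IsStandard (ρ ξ : ℕ) (S : Multiset (ℕ × ℕ)) : Prop :=
  (∀ p ∈ S, p.1 ≤ ρ ∨ ξ ≤ p.2) ∧ ¬ Has3Chain S ∧
    ¬ Has2Chain (S.filter fun p => p.2 < ξ) ∧ ¬ Has2Chain (S.filter fun p => ρ < p.1)

section Ideal

variable (F : Type*) [Field F]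

/-- The monomial with a given multiset of (column, row) indices. -/
noncomputable def swapMonomial {m N : ℕ} (s : Multiset (Fin m × Fin N)) :
    MvPolynomial (Fin N × Fin m) F := (s.map fun a => X (a.2, a.1)).prod

theorem swapMonomial_cons {m N : ℕ} (a : Fin m × Fin N) (s : Multiset (Fin m × Fin N)) :
    swapMonomial F (a ::ₘ s) = X (a.2, a.1) * swapMonomial F s := by
  simp [swapMonomial]

theorem isHomogeneous_swapMonomial {m N : ℕ} (s : Multiset (Fin m × Fin N)) :
    (swapMonomial F s).IsHomogeneous (Multiset.card s) := by
  induction s using Multiset.induction_on with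
  | empty => simpa [swapMonomial] using isHomogeneous_one _ _
  | cons a s ih =>
    rw [swapMonomial_cons, Multiset.card_cons, add_comm]
    exact (isHomogeneous_X F _).mul ih

/-- The substitution `z_{i,j} ↦ x_j y_i + u_j v_i`. -/
noncomputable def genericMatrix (m N ρ ξ : ℕ) :
    MvPolynomial (Fin N × Fin m) F →ₐ[F] MvPolynomial (ℕ × Fin 4) F :=
  aeval fun b => leftTerm F ρ (b.2.1 + 1, b.1.1 + 1) + rightTerm F ξ (b.2.1 + 1, b.1.1 + 1)

theorem genericMatrix_swapMonomial {m N : ℕ} (ρ ξ : ℕ) (s : Multiset (Fin m × Fin N)) :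
    genericMatrix F m N ρ ξ (swapMonomial F s) =
      ((shiftedIndices s).map fun a => leftTerm F ρ a + rightTerm F ξ a).prod := by
  rw [swapMonomial, map_multiset_prod, Multiset.map_map, shiftedIndices, Multiset.map_map]
  refine congrArg _ (Multiset.map_congr rfl fun a _ => ?_)
  simp [genericMatrix]

theorem detIdeal_le_ker_genericMatrix (n n₁ n₂ : ℕ) :
    detIdeal F n n₁ n₂ ≤ RingHom.ker (genericMatrix F n₂ (n - n₁) n₁ (n₂ - n₁ + 1)) := by
  rw [detIdeal, Ideal.span_le]
  rintro p (((⟨i, j, hi, hj, rfl⟩ | ⟨i, i', j, j', hi, hi', hj, hj', rfl⟩) |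
    ⟨i, i', j, j', hi, hi', hj, hj', rfl⟩) | ⟨i₁, i₂, i₃, j₁, j₂, j₃, -, -, -, -, rfl⟩) <;>
    simp only [SetLike.mem_coe, RingHom.mem_ker, genericMatrix, map_add, map_sub, map_mul, aeval_X,
      leftTerm, rightTerm]
  · rw [if_neg (by omega), if_neg (by omega)]
    ring
  · rw [Fin.lt_def] at hi
    rw [if_neg (c := n₂ - n₁ + 1 ≤ i.1 + 1) (by omega),
      if_neg (c := n₂ - n₁ + 1 ≤ i'.1 + 1) (by omega)]
    ring
  · rw [Fin.lt_def] at hj'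
    rw [if_neg (c := j.1 + 1 ≤ n₁) (by omega), if_neg (c := j'.1 + 1 ≤ n₁) (by omega)]
    ring
  · ring

theorem mul_add_mul_lt_of_lt {a a' b b' : ℕ} (h : a < a') (h' : b < b') :
    a * b' + a' * b < a * b + a' * b' := by
  nlinarith

theorem pairWeight_shiftedIndices_cons {m N : ℕ} (a : Fin m × Fin N)
    (s : Multiset (Fin m × Fin N)) : pairWeight (shiftedIndices (a ::ₘ s)) =
      (a.1.1 + 1) * (a.2.1 + 1) + pairWeight (shiftedIndices s) := by
  simp [pairWeight, shiftedIndices]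

/-- Straightening: if `W` contains all multiples of the generators of `detIdeal` and all standard
monomials of degree `k`, then it contains all monomials of degree `k`. -/
theorem swapMonomial_mem {n n₁ n₂ : ℕ} {k : ℕ}
    {W : Submodule F (MvPolynomial (Fin (n - n₁) × Fin n₂) F)}
    (hI : ∀ p ∈ detIdeal F n n₁ n₂, p ∈ W)
    (hstd : ∀ s : Multiset (Fin n₂ × Fin (n - n₁)), Multiset.card s = k →
      IsStandard n₁ (n₂ - n₁ + 1) (shiftedIndices s) → swapMonomial F s ∈ W)
    (s : Multiset (Fin n₂ × Fin (n - n₁))) (hs : Multiset.card s = k) :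
    swapMonomial F s ∈ W := by
  induction hw : pairWeight (shiftedIndices s) using Nat.strong_induction_on generalizing s with
  | _ w ih =>
  subst hw
  have two : ∀ a b : Fin n₂ × Fin (n - n₁), a ∈ s → b ∈ s → a.1 < b.1 → a.2 < b.2 →
      (X (a.2, a.1) * X (b.2, b.1) - X (a.2, b.1) * X (b.2, a.1) :
        MvPolynomial (Fin (n - n₁) × Fin n₂) F) ∈ detIdeal F n n₁ n₂ → swapMonomial F s ∈ W := by
    intro a b ha hb h1 h2 hg
    obtain ⟨r, rfl⟩ := exists_cons_cons_of_mem ha hb (by rintro rfl; exact lt_irrefl _ h1)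
    have hlt := mul_add_mul_lt_of_lt (Nat.succ_lt_succ h1) (Nat.succ_lt_succ h2)
    have e : swapMonomial F (a ::ₘ b ::ₘ r) =
        (X (a.2, a.1) * X (b.2, b.1) - X (a.2, b.1) * X (b.2, a.1)) * swapMonomial F r +
          swapMonomial F ((a.1, b.2) ::ₘ (b.1, a.2) ::ₘ r) := by
      simp only [swapMonomial_cons]; ring
    rw [e]
    refine W.add_mem (hI _ (Ideal.mul_mem_right _ _ hg)) (ih _ ?_ _ (by simpa using hs) rfl)
    simp only [pairWeight_shiftedIndices_cons]
    simp only [Nat.succ_eq_add_one] at hlt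
    linarith
  by_cases h0 : ∀ p ∈ shiftedIndices s, p.1 ≤ n₁ ∨ n₂ - n₁ + 1 ≤ p.2
  swap
  · push Not at h0
    obtain ⟨p, hp, h1, h2⟩ := h0
    obtain ⟨a, ha, rfl⟩ := Multiset.mem_map.1 hp
    obtain ⟨r, rfl⟩ := Multiset.exists_cons_of_mem ha
    rw [swapMonomial_cons]
    refine hI _ (Ideal.mul_mem_right _ _ (Ideal.subset_span ?_))
    exact Or.inl (Or.inl (Or.inl ⟨a.2, a.1, by omega, by omega, rfl⟩))
  have h0' : ∀ a ∈ s, a.1.1 + 1 ≤ n₁ ∨ n₂ - n₁ + 1 ≤ a.2.1 + 1 :=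
    fun a ha => h0 _ (Multiset.mem_map_of_mem _ ha)
  by_cases hξ : Has2Chain ((shiftedIndices s).filter fun p => p.2 < n₂ - n₁ + 1)
  · obtain ⟨p, hp, q, hq, h1, h2⟩ := hξ
    simp only [Multiset.mem_filter, shiftedIndices] at hp hq
    obtain ⟨hp, hp'⟩ := hp
    obtain ⟨hq, hq'⟩ := hq
    obtain ⟨a, ha, rfl⟩ := Multiset.mem_map.1 hp
    obtain ⟨b, hb, rfl⟩ := Multiset.mem_map.1 hq
    have := h0' b hb
    refine two a b ha hb (Nat.lt_of_succ_lt_succ h1) (Nat.lt_of_succ_lt_succ h2)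
      (Ideal.subset_span (Or.inl (Or.inl (Or.inr ⟨a.2, b.2, a.1, b.1,
        Nat.lt_of_succ_lt_succ h2, ?_, Nat.lt_of_succ_lt_succ h1, ?_, rfl⟩)))) <;> omega
  by_cases hρ : Has2Chain ((shiftedIndices s).filter fun p => n₁ < p.1)
  · obtain ⟨p, hp, q, hq, h1, h2⟩ := hρ
    simp only [Multiset.mem_filter, shiftedIndices] at hp hq
    obtain ⟨hp, hp'⟩ := hp
    obtain ⟨hq, hq'⟩ := hq
    obtain ⟨a, ha, rfl⟩ := Multiset.mem_map.1 hp
    obtain ⟨b, hb, rfl⟩ := Multiset.mem_map.1 hq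
    have := h0' a ha
    refine two a b ha hb (Nat.lt_of_succ_lt_succ h1) (Nat.lt_of_succ_lt_succ h2)
      (Ideal.subset_span (Or.inl (Or.inr ⟨a.2, b.2, a.1, b.1, ?_,
        Nat.lt_of_succ_lt_succ h2, ?_, Nat.lt_of_succ_lt_succ h1, rfl⟩))) <;> omega
  by_cases h3 : Has3Chain (shiftedIndices s)
  swap
  · exact hstd s hs ⟨h0, h3, hξ, hρ⟩
  obtain ⟨p, hp, q, hq, t, ht, h1, h1', h2, h2'⟩ := h3
  obtain ⟨a, ha, rfl⟩ := Multiset.mem_map.1 hp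
  obtain ⟨b, hb, rfl⟩ := Multiset.mem_map.1 hq
  obtain ⟨c, hc, rfl⟩ := Multiset.mem_map.1 ht
  obtain ⟨r, rfl⟩ := exists_cons_cons_cons_of_mem ha hb hc (by rintro rfl; exact lt_irrefl _ h1)
    (by rintro rfl; exact lt_irrefl _ (h1.trans h1')) (by rintro rfl; exact lt_irrefl _ h1')
  have e : swapMonomial F (a ::ₘ b ::ₘ c ::ₘ r) =
      (X (a.2, a.1) * X (b.2, b.1) * X (c.2, c.1)
        + X (b.2, a.1) * X (c.2, b.1) * X (a.2, c.1)
        + X (c.2, a.1) * X (a.2, b.1) * X (b.2, c.1)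
        - X (b.2, a.1) * X (a.2, b.1) * X (c.2, c.1)
        - X (a.2, a.1) * X (c.2, b.1) * X (b.2, c.1)
        - X (c.2, a.1) * X (b.2, b.1) * X (a.2, c.1)) * swapMonomial F r
      - swapMonomial F ((a.1, b.2) ::ₘ (b.1, c.2) ::ₘ (c.1, a.2) ::ₘ r)
      - swapMonomial F ((a.1, c.2) ::ₘ (b.1, a.2) ::ₘ (c.1, b.2) ::ₘ r)
      + swapMonomial F ((a.1, b.2) ::ₘ (b.1, a.2) ::ₘ (c.1, c.2) ::ₘ r)
      + swapMonomial F ((a.1, a.2) ::ₘ (b.1, c.2) ::ₘ (c.1, b.2) ::ₘ r)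
      + swapMonomial F ((a.1, c.2) ::ₘ (b.1, b.2) ::ₘ (c.1, a.2) ::ₘ r) := by
    simp only [swapMonomial_cons]; ring
  have l1 := mul_add_mul_lt_of_lt h1 h2
  have l2 := mul_add_mul_lt_of_lt h1' h2'
  have l3 := mul_add_mul_lt_of_lt h1 (h2.trans h2')
  have l4 := mul_add_mul_lt_of_lt h1' (h2.trans h2')
  have l5 := mul_add_mul_lt_of_lt (h1.trans h1') h2
  have l6 := mul_add_mul_lt_of_lt (h1.trans h1') h2'
  have l7 := mul_add_mul_lt_of_lt (h1.trans h1') (h2.trans h2')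
  have l8 := mul_add_mul_lt_of_lt h1 h2'
  have l9 := mul_add_mul_lt_of_lt h1' h2
  dsimp only at l1 l2 l3 l4 l5 l6 l7 l8 l9
  have hg := Ideal.mul_mem_right (swapMonomial F r) _ (Ideal.subset_span
    (Or.inr ⟨a.2, b.2, c.2, a.1, b.1, c.1, Nat.lt_of_succ_lt_succ h2, Nat.lt_of_succ_lt_succ h2',
      Nat.lt_of_succ_lt_succ h1, Nat.lt_of_succ_lt_succ h1', rfl⟩) : _ ∈ detIdeal F n n₁ n₂)
  rw [e]
  refine W.add_mem (W.add_mem (W.add_mem (W.sub_mem (W.sub_mem (hI _ hg)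
    (ih _ ?_ _ ?_ rfl)) (ih _ ?_ _ ?_ rfl)) (ih _ ?_ _ ?_ rfl)) (ih _ ?_ _ ?_ rfl))
    (ih _ ?_ _ ?_ rfl) <;>
    first
    | simpa using hs
    | simp only [pairWeight_shiftedIndices_cons]
      linarith

theorem monomial_eq_smul_swapMonomial {m N : ℕ} (d : Fin N × Fin m →₀ ℕ) (c : F) :
    monomial d c = c • swapMonomial F ((Finsupp.toMultiset d).map Prod.swap) := by
  rw [swapMonomial, Multiset.map_map]
  have : ((fun a : Fin m × Fin N => (X (a.2, a.1) : MvPolynomial (Fin N × Fin m) F)) ∘ Prod.swap) =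
      X := rfl
  rw [this, prod_map_X_eq_monomial, Finsupp.toMultiset_toFinsupp, smul_monomial, smul_eq_mul,
    mul_one]

end Ideal

end StandardMonomials

/-- Proposition 2.2 of the paper: the Hilbert function of the determinantal-type ideal. -/
theorem hilbFn_eq_P2 {F : Type*} [Field F] [CharZero F] (n n₁ n₂ : ℕ)
    (h1 : 1 ≤ n₁) (h2 : n₁ ≤ n₂) (h3 : n₂ < n) (k : ℕ) :
    hilbFn F n n₁ n₂ k = P2 n₂ (n - n₁) n₁ (n₂ - n₁ + 1) k := by
  let H := MvPolynomial.homogeneousSubmodule (Fin (n - n₁) × Fin n₂) F k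
  let J := Submodule.restrictScalars F (detIdeal F n n₁ n₂)
  let ι := {f : Sym (Fin n₂ × Fin (n - n₁)) k //
    IsStandard n₁ (n₂ - n₁ + 1) (shiftedIndices (f : Multiset (Fin n₂ × Fin (n - n₁))))}
  let b : ι → H := fun f => ⟨swapMonomial F f.1.1, by
    have h := isHomogeneous_swapMonomial F f.1.1
    rwa [f.1.2] at h⟩
  let φ := (genericMatrix F n₂ (n - n₁) n₁ (n₂ - n₁ + 1)).toLinearMap
  have hφ : J.comap H.subtype ≤ LinearMap.ker (φ ∘ₗ H.subtype) := fun x hx =>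
    detIdeal_le_ker_genericMatrix F n n₁ n₂ hx
  have hli : LinearIndependent F fun f => (J.comap H.subtype).mkQ (b f) := by
    refine LinearIndependent.of_comp ((J.comap H.subtype).liftQ _ hφ) ?_
    have e : ((J.comap H.subtype).liftQ _ hφ ∘ fun f => (J.comap H.subtype).mkQ (b f)) = fun f : ι =>
        ((shiftedIndices f.1.1).map fun a =>
          leftTerm F n₁ a + rightTerm F (n₂ - n₁ + 1) a).prod :=
      funext fun f => genericMatrix_swapMonomial F n₁ (n₂ - n₁ + 1) f.1.1
    rw [e]
    exact linearIndependent_prod_of_standard F n₁ (n₂ - n₁ + 1)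
      (fun f : ι => shiftedIndices f.1.1)
      ((shiftedIndices_injective _ _).comp (Subtype.val_injective.comp Subtype.val_injective))
      (fun f => f.2.1) (fun f => f.2.2.1) (fun f => f.2.2.2.1) (fun f => f.2.2.2.2)
  have hspan : ⊤ ≤ Submodule.span F (Set.range fun f => (J.comap H.subtype).mkQ (b f)) := by
    rintro x -
    obtain ⟨⟨p, hp⟩, rfl⟩ := Submodule.mkQ_surjective _ x
    have hW : p ∈ J ⊔ Submodule.span F (Set.range fun f => (b f : MvPolynomial _ F)) := by
      rw [p.as_sum]
      refine Submodule.sum_mem _ fun d hd => ?_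
      rw [monomial_eq_smul_swapMonomial]
      refine Submodule.smul_mem _ _ (swapMonomial_mem F (k := k)
        (fun q hq => Submodule.mem_sup_left hq)
        (fun s hs hstd => Submodule.mem_sup_right (Submodule.subset_span
          (Set.mem_range_self (⟨⟨s, hs⟩, hstd⟩ : ι))))
        _ ?_)
      rw [Multiset.card_map, Finsupp.card_toMultiset]
      by_contra hne
      exact MvPolynomial.mem_support_iff.1 hd
        (((MvPolynomial.mem_homogeneousSubmodule _ _).1 hp).coeff_eq_zero hne)
    obtain ⟨i, hi, y, hy, rfl⟩ := Submodule.mem_sup.1 hW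
    obtain ⟨c, rfl⟩ := Finsupp.mem_span_range_iff_exists_finsupp.1 hy
    have : (J.comap H.subtype).mkQ (⟨_, hp⟩ : H) =
        (J.comap H.subtype).mkQ (c.sum fun f a => a • b f) := by
      rw [← sub_eq_zero, ← map_sub, Submodule.mkQ_apply, Submodule.Quotient.mk_eq_zero,
        Submodule.mem_comap, map_sub]
      simpa [Finsupp.sum] using hi
    rw [this]
    exact Finsupp.mem_span_range_iff_exists_finsupp.2 ⟨c, by simp [Finsupp.sum]⟩
  exact Module.finrank_eq_nat_card_basis (Module.Basis.mk hli hspan)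
end

section
/- (Theorem 1, Hilbert series of the associated variety, case n_1 ≤ n_2 < n.) With F, n, n_1, n_2, Z', I as in the context and assuming additionally n_2 ≥ 2 and n_1 ≤ n−2, the following identity holds in ℚ⟦t⟧: (1−t)^{2n−3} · Σ_{k≥0} dim_F(Z'_k/(I ∩ Z'_k)) t^k = Σ_{r,s≥0} [ C(n_2−2,r)·C(n−n_2−1,r)·C(n_1−1,s)·C(n−n_1−1,s) − C(n_2−2,r−1)·C(n−n_2,r)·C(n_1−1,s+1)·C(n−n_1−2,s) ] t^{r+s}. -/
section SupportSeries

variable {σ : Type*} [Fintype σ] [DecidableEq σ]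

open Classical in
/-- The generating function, by total degree, of the monomials in the variables `σ` whose support
satisfies `P`. -/
noncomputable def supportSeries (P : Finset σ → Prop) : PowerSeries ℚ :=
  PowerSeries.mk fun k =>
    (((Finset.univ.finsuppAntidiag k).filter fun m : σ →₀ ℕ => P m.support).card : ℚ)

theorem supportSeries_congr {P Q : Finset σ → Prop} (h : ∀ s, P s ↔ Q s) :
    supportSeries P = supportSeries Q := by
  rw [funext fun s => propext (h s)]

theorem supportSeries_split (P Q : Finset σ → Prop) :
    supportSeries P =
      supportSeries (fun s => P s ∧ Q s) + supportSeries (fun s => P s ∧ ¬ Q s) := by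
  classical
  ext k
  simp only [supportSeries, map_add, PowerSeries.coeff_mk]
  rw [← Finset.card_filter_add_card_filter_not (fun m : σ →₀ ℕ => Q m.support)]
  simp [Finset.filter_filter]

theorem supportSeries_empty : supportSeries (fun s : Finset σ => s = ∅) = 1 := by
  classical
  ext k
  simp only [supportSeries, PowerSeries.coeff_mk, PowerSeries.coeff_one]
  split_ifs with h
  · subst h; simp [Finset.filter_singleton]
  · rw [Nat.cast_eq_zero, Finset.card_eq_zero, Finset.filter_eq_empty_iff]
    intro m hm h0
    simp only [Finsupp.support_eq_empty] at h0
    subst h0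
    simp at hm
    omega

/-- If `c` is a cone point of the family `P` of supports, then `(1 - t)` times the series of `P`
is the series of the members of `P` avoiding `c`. -/
theorem supportSeries_cone {P : Finset σ → Prop} (c : σ) (h : ∀ s, P (insert c s) ↔ P s) :
    (1 - PowerSeries.X) * supportSeries P = supportSeries (fun s => P s ∧ c ∉ s) := by
  classical
  suffices hX : PowerSeries.X * supportSeries P = supportSeries (fun s => P s ∧ c ∈ s) by
    rw [sub_mul, one_mul, hX, sub_eq_iff_eq_add', ← supportSeries_split P (fun s => c ∈ s)]
  ext k
  cases k with
  | zero =>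
    simp [supportSeries, Finset.filter_singleton]
  | succ k =>
    rw [PowerSeries.coeff_succ_X_mul]
    simp only [supportSeries, PowerSeries.coeff_mk]
    congr 1
    have key : ∀ m : σ →₀ ℕ, (m + Finsupp.single c 1).support = insert c m.support := by
      intro m
      ext x
      by_cases hx : x = c
      · subst hx; simp
      · simp [hx]
    refine Finset.card_bij (fun m _ => m + Finsupp.single c 1) ?_ ?_ ?_
    · intro m hm
      simp only [Finset.mem_filter, Finset.mem_finsuppAntidiag] at hm ⊢
      rw [key, h]
      refine ⟨⟨?_, Finset.subset_univ _⟩, hm.2, Finset.mem_insert_self _ _⟩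
      simp [Finset.sum_add_distrib, hm.1.1, Finsupp.single_apply]
    · intro m _ m' _ hmm
      exact add_right_cancel hmm
    · intro m hm
      simp only [Finset.mem_filter, Finset.mem_finsuppAntidiag] at hm
      have hle : Finsupp.single c 1 ≤ m := by
        rw [Finsupp.single_le_iff]
        exact Nat.one_le_iff_ne_zero.mpr (Finsupp.mem_support_iff.mp hm.2.2)
      obtain ⟨m', rfl⟩ := exists_add_of_le hle
      rw [add_comm] at hm
      refine ⟨m', ?_, add_comm _ _⟩
      simp only [Finset.mem_filter, Finset.mem_finsuppAntidiag]
      rw [key, h] at hm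
      refine ⟨⟨?_, Finset.subset_univ _⟩, hm.2.1⟩
      have := hm.1.1
      simp [Finset.sum_add_distrib, Finsupp.single_apply] at this
      exact this

end SupportSeries

section Multichoose

open PowerSeries

/-- The series `∑ₖ ((u, k)) ((w, k + d)) tᵏ`, where `((m, k))` is the multiset coefficient. -/
noncomputable def multichooseSeries (u w d : ℕ) : PowerSeries ℚ :=
  PowerSeries.mk fun k => ((Nat.multichoose u k * Nat.multichoose w (k + d) : ℕ) : ℚ)

theorem multichooseSeries_rec (u w d : ℕ) :
    (1 - X) * multichooseSeries (u + 1) (w + 1) d =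
      multichooseSeries (u + 1) w d + multichooseSeries u (w + 1) d - multichooseSeries u w d := by
  ext k
  rw [sub_mul, one_mul]
  cases k with
  | zero =>
    cases d with
    | zero => simp [multichooseSeries]
    | succ d => simp [multichooseSeries, Nat.multichoose_succ_succ]
  | succ k =>
    simp only [map_sub, map_add, coeff_succ_X_mul, multichooseSeries, coeff_mk,
      Nat.multichoose_succ_succ, Nat.add_right_comm k 1 d]
    push_cast
    ring

theorem multichooseSeries_zero_left (w : ℕ) : multichooseSeries 0 w 0 = 1 := by
  ext k
  cases k <;> simp [multichooseSeries, coeff_one]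

theorem multichooseSeries_zero_right (u : ℕ) : multichooseSeries u 0 0 = 1 := by
  ext k
  cases k <;> simp [multichooseSeries, coeff_one]

theorem multichooseSeries_zero_one (u : ℕ) : multichooseSeries u 0 1 = 0 := by
  ext k
  simp [multichooseSeries]

theorem multichooseSeries_one_sub (u w : ℕ) :
    multichooseSeries u (w + 1) 1 - multichooseSeries u w 1 = multichooseSeries u (w + 1) 0 := by
  ext k
  simp [multichooseSeries, Nat.multichoose_succ_succ]
  ring

theorem multichooseSeries_zero_sub (u w : ℕ) :
    multichooseSeries u (w + 1) 0 - multichooseSeries u w 0 =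
      X * multichooseSeries (w + 1) u 1 := by
  ext k
  cases k with
  | zero => simp [multichooseSeries]
  | succ k =>
    simp only [map_sub, coeff_succ_X_mul, multichooseSeries, coeff_mk, add_zero,
      Nat.multichoose_succ_succ]
    push_cast
    ring

theorem multichooseSeries_succ_left (u w d : ℕ) :
    (u : PowerSeries ℚ) * multichooseSeries (u + 1) w d =
      (u : PowerSeries ℚ) * multichooseSeries u w d +
        X * derivative ℚ (multichooseSeries u w d) := by
  ext k
  have h : (u : ℚ) * Nat.multichoose (u + 1) k = (u + k) * Nat.multichoose u k := by
    rcases u with _ | u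
    · cases k <;> simp
    · have := Nat.add_one_mul_choose_eq (u + k) u
      have h1 : Nat.multichoose (u + 1 + 1) k = (u + k + 1).choose (u + 1) := by
        rw [Nat.multichoose_eq, ← Nat.choose_symm (by omega)]; congr 1 <;> omega
      have h2 : Nat.multichoose (u + 1) k = (u + k).choose u := by
        rw [Nat.multichoose_eq, ← Nat.choose_symm (by omega)]; congr 1 <;> omega
      rw [h1, h2]
      have h3 : (((u + k + 1) * (u + k).choose u : ℕ) : ℚ) =
          ((u + k + 1).choose (u + 1) * (u + 1) : ℕ) := by
        exact_mod_cast this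
      push_cast at h3 ⊢
      linarith
  rw [← map_natCast (C : ℚ →+* PowerSeries ℚ) u, map_add, coeff_C_mul, coeff_C_mul]
  cases k with
  | zero =>
    simp [multichooseSeries]
  | succ k =>
    rw [coeff_succ_X_mul, coeff_derivative]
    simp only [multichooseSeries, coeff_mk]
    push_cast at h ⊢
    linear_combination (Nat.multichoose w (k + 1 + d) : ℚ) * h

theorem cast_choose_mul_sub (n k : ℕ) :
    (Nat.choose n k : ℚ) * (n - k) = Nat.choose n (k + 1) * (k + 1) := by
  rcases le_or_gt k n with h | h
  · rw [← Nat.cast_sub h]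
    exact_mod_cast (Nat.choose_succ_right_eq n k).symm
  · rw [Nat.choose_eq_zero_of_lt h, Nat.choose_eq_zero_of_lt (by omega)]
    simp

/-- Euler's transformation for the hypergeometric series `multichooseSeries`. -/
theorem one_sub_X_pow_mul_multichooseSeries (e w d : ℕ) :
    (1 - X) ^ (e + d + w + 1) * multichooseSeries (e + d + 1) (w + 1) d =
      PowerSeries.mk fun r => ((Nat.choose e r * Nat.choose (w + d) (r + d) : ℕ) : ℚ) := by
  induction e with
  | zero =>
    have : multichooseSeries (0 + d + 1) (w + 1) d = C (Nat.choose (w + d) d : ℚ) *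
        (PowerSeries.mk fun k => (Nat.choose (d + w + k) (d + w) : ℚ)) := by
      ext k
      rw [coeff_C_mul]
      simp only [multichooseSeries, coeff_mk]
      norm_cast
      have h := Nat.choose_mul (n := d + w + k) (k := d + w) (s := w) (by omega)
      rw [show d + w + k - w = k + d by omega, show d + w - w = d by omega] at h
      rw [Nat.multichoose_eq, Nat.multichoose_eq, mul_comm (Nat.choose (w + d) d),
        ← Nat.choose_symm_add (a := w) (b := d), Nat.add_comm w d, h,
        show 0 + d + 1 + k - 1 = k + d by omega, Nat.choose_symm_add,
        show w + 1 + (k + d) - 1 = (k + d) + w by omega, Nat.choose_symm_add, mul_comm,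
        show d + w + k = k + d + w by omega]
    rw [this, mul_left_comm, mul_comm ((1 - X) ^ _), zero_add,
      PowerSeries.mk_add_choose_mul_one_sub_pow_eq_one, mul_one]
    ext k
    rw [coeff_C, coeff_mk]
    cases k <;> simp
  | succ e ih =>
    set G := multichooseSeries (e + d + 1) (w + 1) d with hG
    set F := PowerSeries.mk fun r => ((Nat.choose e r * Nat.choose (w + d) (r + d) : ℕ) : ℚ)
      with hF
    have h1 := multichooseSeries_succ_left (e + d + 1) (w + 1) d
    have hne : ((e + d + 1 : ℕ) : PowerSeries ℚ) ≠ 0 := by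
      rw [← map_natCast (C : ℚ →+* PowerSeries ℚ)]
      simp only [ne_eq, _root_.map_eq_zero]
      exact_mod_cast Nat.succ_ne_zero (e + d)
    apply mul_left_cancel₀ hne
    have hD : (1 - X) * derivative ℚ F + ((e + d + w + 1 : ℕ) : PowerSeries ℚ) * F =
        (1 - X) ^ (e + d + w + 2) * derivative ℚ G := by
      rw [← ih]
      simp only [Derivation.leibniz, Derivation.leibniz_pow, smul_eq_mul, map_sub, derivative_X]
      simp
      ring
    have h2 : ((e + d + 1 : ℕ) : PowerSeries ℚ) * ((1 - X) ^ (e + 1 + d + w + 1) *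
        multichooseSeries (e + 1 + d + 1) (w + 1) d) =
        ((e + d + 1 : ℕ) : PowerSeries ℚ) * F + X * ((1 - X) * derivative ℚ F +
          (((e + d + w + 1 : ℕ) : PowerSeries ℚ) - ((e + d + 1 : ℕ) : PowerSeries ℚ)) * F) := by
      rw [sub_mul (_ : PowerSeries ℚ) _ F, ← add_sub_assoc, hD, ← ih,
        show e + 1 + d + 1 = e + d + 1 + 1 by omega]
      push_cast at h1 ⊢
      linear_combination (1 - X) ^ (e + d + w + 2) * h1
    rw [h2, ← Nat.cast_sub (by omega), show e + d + w + 1 - (e + d + 1) = w by omega,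
      sub_mul (1 : PowerSeries ℚ), one_mul]
    simp only [← map_natCast (C : ℚ →+* PowerSeries ℚ)]
    ext r
    rw [map_add, coeff_C_mul, coeff_C_mul]
    cases r with
    | zero => simp [hF]
    | succ r =>
      rw [coeff_succ_X_mul, map_add, map_sub, coeff_C_mul, coeff_derivative]
      have h3 : coeff r (X * derivative ℚ F) = r * coeff r F := by
        cases r with
        | zero => simp
        | succ r =>
          rw [coeff_succ_X_mul, coeff_derivative, mul_comm]
          push_cast
          rfl
      have h4 := cast_choose_mul_sub (w + d) (r + d)
      have h5 := cast_choose_mul_sub e r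
      rw [h3]
      simp only [hF, coeff_mk, Nat.choose_succ_succ' e r, Nat.add_right_comm r 1 d]
      push_cast at h4 h5 ⊢
      linear_combination (Nat.choose e r : ℚ) * h4 - ((w + d).choose (r + d + 1) : ℚ) * h5

theorem one_sub_X_pow_mul_multichooseSeries_one (e w : ℕ) :
    (1 - X) ^ (e + 1 + w) * multichooseSeries (e + 2) w 1 =
      PowerSeries.mk fun r => ((Nat.choose e r * Nat.choose w (r + 1) : ℕ) : ℚ) := by
  cases w with
  | zero =>
    rw [multichooseSeries_zero_one, mul_zero]
    ext r
    simp
  | succ w => exact one_sub_X_pow_mul_multichooseSeries e w 1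

end Multichoose


section LadderSupport

/-- Supports of monomials in the columns `≥ j` and the rows `< v` of a `p × q` matrix, outside of
the block of rows `< a` and columns `≥ b`, that contain no strict chain of length three, such that
every strict chain of length two starts in a row `< u` and a column `< b` and ends in a
row `≥ a`. -/
def LadderSupport (p q a b j u v : ℕ) (s : Finset (Fin p × Fin q)) : Prop :=
  (∀ x ∈ s, j ≤ (x.2 : ℕ) ∧ (x.1 : ℕ) < v ∧ ((x.1 : ℕ) < a → (x.2 : ℕ) < b) ∧
    (u ≤ (x.1 : ℕ) → a ≤ (x.1 : ℕ))) ∧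
  (∀ x ∈ s, ∀ y ∈ s, (x.1 : ℕ) < y.1 → (x.2 : ℕ) < y.2 →
    (x.1 : ℕ) < u ∧ (x.2 : ℕ) < b ∧ a ≤ (y.1 : ℕ)) ∧
  ∀ x ∈ s, ∀ y ∈ s, ∀ z ∈ s, (x.1 : ℕ) < y.1 → (x.2 : ℕ) < y.2 →
    (y.1 : ℕ) < z.1 → ¬ (y.2 : ℕ) < z.2

/-- The members of `LadderSupport` whose cells in column `j` lie in rows `< u`. -/
def LadderSupportBelow (p q a b j u v : ℕ) (s : Finset (Fin p × Fin q)) : Prop :=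
  LadderSupport p q a b j u v s ∧ ∀ x ∈ s, (x.2 : ℕ) = j → (x.1 : ℕ) < u

variable {p q a b j u v : ℕ} {c : Fin p × Fin q} {s : Finset (Fin p × Fin q)}

theorem LadderSupport.mono {t : Finset (Fin p × Fin q)} (h : LadderSupport p q a b j u v t)
    (hst : s ⊆ t) : LadderSupport p q a b j u v s :=
  ⟨fun x hx => h.1 x (hst hx), fun x hx y hy => h.2.1 x (hst hx) y (hst hy),
    fun x hx y hy z hz => h.2.2 x (hst hx) y (hst hy) z (hst hz)⟩

theorem ladderSupport_insert (hc₁ : (c.1 : ℕ) = v) (hc₂ : (c.2 : ℕ) = j) (hav : a ≤ v) :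
    LadderSupport p q a b j u (v + 1) (insert c s) ↔ LadderSupport p q a b j u (v + 1) s := by
  refine ⟨fun h => h.mono (Finset.subset_insert _ _), fun ⟨h1, h2, h3⟩ => ⟨?_, ?_, ?_⟩⟩
  · intro x hx
    obtain rfl | hx := Finset.mem_insert.mp hx
    · omega
    · exact h1 x hx
  · intro x hx y hy
    obtain rfl | hxs := Finset.mem_insert.mp hx <;> obtain rfl | hys := Finset.mem_insert.mp hy
    · omega
    · have := h1 y hys
      omega
    · have := h1 x hxs
      omega
    · exact h2 x hxs y hys
  · intro x hx y hy z hz hxy hxy'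
    have hx' : x ∈ s := by
      obtain rfl | hx := Finset.mem_insert.mp hx
      · obtain rfl | hy := Finset.mem_insert.mp hy
        · omega
        · have := h1 y hy
          omega
      · exact hx
    have := h1 x hx'
    obtain rfl | hy := Finset.mem_insert.mp hy
    · omega
    · have := h1 y hy
      obtain rfl | hz := Finset.mem_insert.mp hz
      · omega
      · exact h3 x hx' y hy z hz hxy hxy'

theorem ladderSupportBelow_insert (hc₁ : (c.1 : ℕ) = u) (hc₂ : (c.2 : ℕ) = j) (hjb : j < b)
    (huv : u < v) :
    LadderSupportBelow p q a b j (u + 1) v (insert c s) ↔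
      LadderSupportBelow p q a b j (u + 1) v s := by
  refine ⟨fun h => ⟨h.1.mono (Finset.subset_insert _ _),
    fun x hx => h.2 x (Finset.mem_insert_of_mem hx)⟩, fun ⟨⟨h1, h2, h3⟩, h4⟩ => ⟨⟨?_, ?_, ?_⟩, ?_⟩⟩
  · intro x hx
    obtain rfl | hx := Finset.mem_insert.mp hx
    · omega
    · exact h1 x hx
  · intro x hx y hy
    obtain rfl | hxs := Finset.mem_insert.mp hx <;> obtain rfl | hys := Finset.mem_insert.mp hy
    · omega
    · have := h1 y hys
      omega
    · have := h1 x hxs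
      omega
    · exact h2 x hxs y hys
  · intro x hx y hy z hz hxy hxy' hyz hyz'
    have hy' : y ∈ s := by
      obtain rfl | hy := Finset.mem_insert.mp hy
      · obtain rfl | hx := Finset.mem_insert.mp hx
        · omega
        · have := h1 x hx
          omega
      · exact hy
    have := h1 y hy'
    have hz' : z ∈ s := by
      obtain rfl | hz := Finset.mem_insert.mp hz
      · omega
      · exact hz
    have := h2 y hy' z hz' hyz hyz'
    obtain rfl | hx := Finset.mem_insert.mp hx
    · omega
    · exact h3 x hx y hy' z hz' hxy hxy' hyz hyz'
  · intro x hx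
    obtain rfl | hx := Finset.mem_insert.mp hx
    · omega
    · exact h4 x hx

theorem ladderSupport_notMem_iff (hc₁ : (c.1 : ℕ) = v) (hc₂ : (c.2 : ℕ) = j) :
    ((LadderSupport p q a b j u (v + 1) s ∧ c ∉ s) ∧
        ¬ ∀ x ∈ s, (x.2 : ℕ) = j → (x.1 : ℕ) < u) ↔
      LadderSupport p q a b j u v s ∧ ¬ ∀ x ∈ s, (x.2 : ℕ) = j → (x.1 : ℕ) < u := by
  have hne : ∀ x ∈ s, c ∉ s → ¬ ((x.1 : ℕ) = v ∧ (x.2 : ℕ) = j) := by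
    rintro x hx hc ⟨h, h'⟩
    exact hc (by rwa [Prod.ext (Fin.ext (hc₁.trans h.symm)) (Fin.ext (hc₂.trans h'.symm))])
  simp only [LadderSupport]
  constructor
  · rintro ⟨⟨⟨h1, h2, h3⟩, hc⟩, hn⟩
    refine ⟨⟨?_, h2, h3⟩, hn⟩
    push Not at hn
    obtain ⟨w, hw, hwj, hwu⟩ := hn
    intro x hx
    have := h1 x hx
    have := hne w hw hc
    have := hne x hx hc
    have := h1 w hw
    have := h2 w hw x hx
    omega
  · rintro ⟨⟨h1, h2, h3⟩, hn⟩
    refine ⟨⟨⟨?_, h2, h3⟩, ?_⟩, hn⟩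
    · intro x hx
      have := h1 x hx
      omega
    · intro hc
      have := h1 _ hc
      omega

theorem ladderSupportBelow_notMem_iff (hc₁ : (c.1 : ℕ) = u) (hc₂ : (c.2 : ℕ) = j) (hjb : j < b) :
    ((LadderSupportBelow p q a b j (u + 1) v s ∧ c ∉ s) ∧ ¬ ∀ x ∈ s, (x.2 : ℕ) ≠ j) ↔
      LadderSupportBelow p q a b j u v s ∧ ¬ ∀ x ∈ s, (x.2 : ℕ) ≠ j := by
  have hne : ∀ x ∈ s, c ∉ s → ¬ ((x.1 : ℕ) = u ∧ (x.2 : ℕ) = j) := by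
    rintro x hx hc ⟨h, h'⟩
    exact hc (by rwa [Prod.ext (Fin.ext (hc₁.trans h.symm)) (Fin.ext (hc₂.trans h'.symm))])
  simp only [LadderSupportBelow, LadderSupport]
  constructor
  · rintro ⟨⟨⟨⟨h1, h2, h3⟩, h4⟩, hc⟩, hn⟩
    push Not at hn
    obtain ⟨w, hw, hwj⟩ := id hn
    have := h1 w hw
    have := h4 w hw
    have := hne w hw hc
    refine ⟨⟨⟨?_, ?_, h3⟩, ?_⟩, by push Not; exact hn⟩
    · intro x hx
      have := h1 x hx
      have := h2 w hw x hx
      have := hne x hx hc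
      omega
    · intro x hx y hy hxy hxy'
      have := h1 x hx
      have := h2 x hx y hy hxy hxy'
      have := h3 w hw x hx y hy
      have := hne x hx hc
      omega
    · intro x hx hxj
      have := h4 x hx
      have := hne x hx hc
      omega
  · rintro ⟨⟨⟨h1, h2, h3⟩, h4⟩, hn⟩
    refine ⟨⟨⟨⟨?_, ?_, h3⟩, ?_⟩, ?_⟩, hn⟩
    · intro x hx
      have := h1 x hx
      omega
    · intro x hx y hy hxy hxy'
      have := h2 x hx y hy hxy hxy'
      omega
    · intro x hx hxj
      have := h4 x hx
      omega
    · intro hc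
      have := h4 _ hc
      omega

theorem ladderSupportBelow_iff_succ :
    (LadderSupportBelow p q a b j u v s ∧ ∀ x ∈ s, (x.2 : ℕ) ≠ j) ↔
      LadderSupport p q a b (j + 1) u v s := by
  simp only [LadderSupportBelow, LadderSupport]
  constructor
  · rintro ⟨⟨⟨h1, h2, h3⟩, h4⟩, hn⟩
    refine ⟨fun x hx => ?_, h2, h3⟩
    have := h1 x hx
    have := hn x hx
    omega
  · rintro ⟨h1, h2, h3⟩
    refine ⟨⟨⟨fun x hx => ?_, h2, h3⟩, fun x hx => ?_⟩, fun x hx => ?_⟩ <;>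
    · have := h1 x hx
      omega

theorem ladderSupportBelow_zero_iff :
    LadderSupportBelow p q a b j 0 v s ↔ LadderSupport p q a b (j + 1) 0 v s := by
  rw [← ladderSupportBelow_iff_succ, iff_self_and]
  intro h x hx hj
  have := h.2 x hx hj
  omega

theorem ladderSupport_iff_below (h : v ≤ u ∨ v ≤ a) :
    LadderSupport p q a b j u v s ↔ LadderSupportBelow p q a b j u v s := by
  rw [LadderSupportBelow, iff_self_and]
  rintro ⟨h1, -⟩ x hx -
  have := h1 x hx
  omega

theorem ladderSupport_iff_zero (hj : b ≤ j) :
    LadderSupport p q a b j u v s ↔ LadderSupport p q a b j 0 v s := by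
  simp only [LadderSupport]
  constructor
  · rintro ⟨h1, h2, h3⟩
    refine ⟨fun x hx => ?_, fun x hx y hy hxy hxy' => ?_, h3⟩
    · have := h1 x hx
      omega
    · have := h1 x hx
      have := h2 x hx y hy hxy hxy'
      omega
  · rintro ⟨h1, h2, h3⟩
    refine ⟨fun x hx => ?_, fun x hx y hy hxy hxy' => ?_, h3⟩
    · have := h1 x hx
      omega
    · have := h1 x hx
      have := h2 x hx y hy hxy hxy'
      omega

theorem ladderSupport_iff_empty (hj : q ≤ j) : LadderSupport p q a b j u v s ↔ s = ∅ := by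
  constructor
  · rintro ⟨h1, -⟩
    rw [Finset.eq_empty_iff_forall_notMem]
    intro x hx
    have := h1 x hx
    omega
  · rintro rfl
    simp [LadderSupport]

end LadderSupport

section LadderSeries

open PowerSeries

variable {p q a b j u v w : ℕ}

theorem one_sub_X_mul_ladderSupport (hav : a ≤ v) (huv : u ≤ v) (hv : v < p) (hj : j < q) :
    (1 - X) * supportSeries (LadderSupport p q a b j u (v + 1)) =
      supportSeries (LadderSupportBelow p q a b j u (v + 1)) +
        supportSeries (LadderSupport p q a b j u v) -
        supportSeries (LadderSupportBelow p q a b j u v) := by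
  rw [supportSeries_cone (⟨v, hv⟩, ⟨j, hj⟩) fun s => ladderSupport_insert rfl rfl hav,
    supportSeries_split _ fun s => ∀ x ∈ s, (x.2 : ℕ) = j → (x.1 : ℕ) < u,
    supportSeries_congr fun s => ladderSupport_notMem_iff rfl rfl,
    supportSeries_split (LadderSupport p q a b j u v) fun s =>
      ∀ x ∈ s, (x.2 : ℕ) = j → (x.1 : ℕ) < u]
  have h : ∀ s : Finset (Fin p × Fin q), ((LadderSupport p q a b j u (v + 1) s ∧
      ((⟨v, hv⟩, ⟨j, hj⟩) : Fin p × Fin q) ∉ s) ∧ ∀ x ∈ s, (x.2 : ℕ) = j → (x.1 : ℕ) < u) ↔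
      LadderSupportBelow p q a b j u (v + 1) s := by
    refine fun s => ⟨fun h => ⟨h.1.1, h.2⟩, fun h => ⟨⟨h.1, fun hc => ?_⟩, h.2⟩⟩
    have := h.2 _ hc rfl
    dsimp only at this
    omega
  rw [supportSeries_congr h]
  unfold LadderSupportBelow
  ring

theorem one_sub_X_mul_ladderSupportBelow (hjb : j < b) (hbq : b ≤ q) (huv : u < v) (hv : v ≤ p) :
    (1 - X) * supportSeries (LadderSupportBelow p q a b j (u + 1) v) =
      supportSeries (LadderSupport p q a b (j + 1) (u + 1) v) +
        supportSeries (LadderSupportBelow p q a b j u v) -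
        supportSeries (LadderSupport p q a b (j + 1) u v) := by
  rw [supportSeries_cone (⟨u, by omega⟩, ⟨j, by omega⟩) fun s =>
      ladderSupportBelow_insert rfl rfl hjb huv,
    supportSeries_split _ fun s => ∀ x ∈ s, (x.2 : ℕ) ≠ j,
    supportSeries_congr fun s => ladderSupportBelow_notMem_iff rfl rfl hjb,
    supportSeries_split (LadderSupportBelow p q a b j u v) fun s => ∀ x ∈ s, (x.2 : ℕ) ≠ j,
    supportSeries_congr fun s => ladderSupportBelow_iff_succ (s := s)]
  have h : ∀ s : Finset (Fin p × Fin q), ((LadderSupportBelow p q a b j (u + 1) v s ∧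
      ((⟨u, by omega⟩, ⟨j, by omega⟩) : Fin p × Fin q) ∉ s) ∧ ∀ x ∈ s, (x.2 : ℕ) ≠ j) ↔
      LadderSupport p q a b (j + 1) (u + 1) v s := by
    intro s
    rw [← ladderSupportBelow_iff_succ]
    exact ⟨fun h => ⟨h.1.1, h.2⟩, fun h => ⟨⟨h.1, fun hc => h.2 _ hc rfl⟩, h.2⟩⟩
  rw [supportSeries_congr h]
  ring

theorem one_sub_X_ne_zero : (1 - X : PowerSeries ℚ) ≠ 0 := by
  intro h
  have := congrArg constantCoeff h
  simp at this

theorem supportSeries_ladderSupport_right (k : ℕ) (hj : b ≤ j) (hk : j + k = q) (hv : v ≤ p) :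
    supportSeries (LadderSupport p q a b j u v) = multichooseSeries (v - a) k 0 := by
  induction k generalizing j u v with
  | zero =>
    rw [supportSeries_congr fun s => ladderSupport_iff_empty (by omega), supportSeries_empty,
      multichooseSeries_zero_right]
  | succ k ih =>
    rw [supportSeries_congr fun s => ladderSupport_iff_zero hj]
    have hbelow : ∀ v ≤ p, supportSeries (LadderSupportBelow p q a b j 0 v) =
        multichooseSeries (v - a) k 0 := fun v hv => by
      rw [supportSeries_congr fun s => ladderSupportBelow_zero_iff, ih (by omega) (by omega) hv]
    induction v with
    | zero =>
      rw [supportSeries_congr fun s => ladderSupport_iff_below (Or.inl le_rfl), hbelow 0 hv,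
        Nat.zero_sub, multichooseSeries_zero_left, multichooseSeries_zero_left]
    | succ v ihv =>
      rcases Nat.lt_or_ge v a with hva | hav
      · rw [supportSeries_congr fun s => ladderSupport_iff_below (Or.inr hva), hbelow _ hv,
          Nat.sub_eq_zero_of_le hva, multichooseSeries_zero_left, multichooseSeries_zero_left]
      · apply mul_left_cancel₀ one_sub_X_ne_zero
        rw [one_sub_X_mul_ladderSupport hav v.zero_le hv (by omega), hbelow _ hv,
          hbelow v (by omega), ihv (by omega), Nat.sub_add_comm hav, multichooseSeries_rec]

theorem supportSeries_ladderSupportBelow_of_succ (hq : q = b + a) (hjb : j < b)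
    (ih : ∀ u v, u ≤ v → v ≤ p → supportSeries (LadderSupport p q a b (j + 1) u v) =
      multichooseSeries u w 0 * multichooseSeries (v - a) (w + a) 0 -
        X * multichooseSeries (w + a) (u - a) 1 * multichooseSeries v w 1)
    (huv : u ≤ v) (hv : v ≤ p) :
    supportSeries (LadderSupportBelow p q a b j u v) =
      multichooseSeries u (w + 1) 0 * multichooseSeries (v - a) (w + a) 0 -
        X * multichooseSeries (w + a + 1) (u - a) 1 * multichooseSeries v w 1 := by
  induction u with
  | zero =>
    rw [supportSeries_congr fun s => ladderSupportBelow_zero_iff, ih 0 v huv hv]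
    simp only [Nat.zero_sub, multichooseSeries_zero_left, multichooseSeries_zero_one]
  | succ u ihu =>
    apply mul_left_cancel₀ one_sub_X_ne_zero
    rw [one_sub_X_mul_ladderSupportBelow hjb (by omega) huv hv, ih _ v huv hv, ihu (by omega),
      ih u v (by omega) hv]
    have h1 := multichooseSeries_rec u w 0
    have h2 : (1 - X) * multichooseSeries (w + a + 1) (u + 1 - a) 1 =
        multichooseSeries (w + a) (u + 1 - a) 1 + multichooseSeries (w + a + 1) (u - a) 1 -
          multichooseSeries (w + a) (u - a) 1 := by
      rcases Nat.lt_or_ge u a with hua | hau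
      · rw [Nat.sub_eq_zero_of_le hua, Nat.sub_eq_zero_of_le hua.le]
        simp [multichooseSeries_zero_one]
      · rw [Nat.sub_add_comm hau, multichooseSeries_rec]
        ring
    linear_combination (-multichooseSeries (v - a) (w + a) 0) * h1 +
      X * multichooseSeries v w 1 * h2

/-- The series of the ladder supports in the columns `≥ j`, where `j + w = b`. -/
theorem supportSeries_ladderSupport (w : ℕ) (hq : q = b + a) (hw : j + w = b) (huv : u ≤ v)
    (hv : v ≤ p) :
    supportSeries (LadderSupport p q a b j u v) =
      multichooseSeries u w 0 * multichooseSeries (v - a) (w + a) 0 -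
        X * multichooseSeries (w + a) (u - a) 1 * multichooseSeries v w 1 := by
  induction w generalizing j u v with
  | zero =>
    rw [supportSeries_ladderSupport_right (0 + a) (by omega) (by omega) hv,
      multichooseSeries_zero_right, multichooseSeries_zero_one]
    ring
  | succ w ih =>
    have hbelow : ∀ v, u ≤ v → v ≤ p → supportSeries (LadderSupportBelow p q a b j u v) = _ :=
      fun v => supportSeries_ladderSupportBelow_of_succ hq (by omega)
        (fun u v => ih (j := j + 1) (by omega))
    rw [Nat.add_right_comm]
    have hbase : ∀ v, u ≤ v → v ≤ p → u = v ∨ v ≤ a →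
        supportSeries (LadderSupport p q a b j u v) =
        multichooseSeries u (w + 1) 0 * multichooseSeries (v - a) (w + a + 1) 0 -
          X * multichooseSeries (w + a + 1) (u - a) 1 * multichooseSeries v (w + 1) 1 := by
      intro v huv hv h
      rw [supportSeries_congr fun s => ladderSupport_iff_below (by omega), hbelow v huv hv]
      rcases h with rfl | hva
      · linear_combination X * multichooseSeries (w + a + 1) (u - a) 1 *
          multichooseSeries_one_sub u w - multichooseSeries u (w + 1) 0 *
          multichooseSeries_zero_sub (u - a) (w + a)
      · rw [Nat.sub_eq_zero_of_le hva, Nat.sub_eq_zero_of_le (huv.trans hva)]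
        simp only [multichooseSeries_zero_left, multichooseSeries_zero_one]
        ring
    induction v with
    | zero => exact hbase 0 huv hv (by omega)
    | succ v ihv =>
      by_cases h : u = v + 1 ∨ v + 1 ≤ a
      · exact hbase _ huv hv h
      · apply mul_left_cancel₀ one_sub_X_ne_zero
        rw [one_sub_X_mul_ladderSupport (by omega) (by omega) hv (by omega), hbelow _ huv hv,
          hbelow v (by omega) (by omega), ihv (by omega) (by omega),
          Nat.sub_add_comm (show a ≤ v by omega)]
        have h1 := multichooseSeries_rec (v - a) (w + a) 0
        have h2 := multichooseSeries_rec v w 1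
        linear_combination (-multichooseSeries u (w + 1) 0) * h1 +
          X * multichooseSeries (w + a + 1) (u - a) 1 * h2

theorem one_sub_X_pow_mul_supportSeries_ladderSupport (n n₁ n₂ : ℕ) (h1 : 1 ≤ n₁) (h2 : n₁ ≤ n₂)
    (h3 : n₂ < n) (h4 : 2 ≤ n₂) (h5 : n₁ ≤ n - 2) :
    (1 - X) ^ (2 * n - 3) * supportSeries
        (LadderSupport (n - n₁) n₂ (n₂ - n₁) n₁ 0 (n - n₁) (n - n₁)) =
      PowerSeries.mk (fun k => ∑ r ∈ Finset.range (k + 1),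
        (((Nat.choose (n₂ - 2) r * Nat.choose (n - n₂ - 1) r *
            Nat.choose (n₁ - 1) (k - r) * Nat.choose (n - n₁ - 1) (k - r) : ℕ) : ℚ) -
          (if r = 0 then 0 else
            ((Nat.choose (n₂ - 2) (r - 1) * Nat.choose (n - n₂) r *
              Nat.choose (n₁ - 1) (k - r + 1) * Nat.choose (n - n₁ - 2) (k - r) : ℕ) : ℚ)))) := by
  obtain ⟨b, rfl⟩ : ∃ b, n₁ = b + 1 := ⟨n₁ - 1, by omega⟩
  obtain ⟨c, rfl⟩ : ∃ c, n₂ = c + 2 := ⟨n₂ - 2, by omega⟩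
  obtain ⟨d, rfl⟩ : ∃ d, n = c + 2 + d + 1 := ⟨n - (c + 2) - 1, by omega⟩
  obtain ⟨e, he⟩ : ∃ e, c + 2 + d + 1 - (b + 1) = e + 2 := ⟨c + 2 + d + 1 - (b + 1) - 2, by omega⟩
  rw [he, supportSeries_congr fun s => ladderSupport_iff_below (Or.inl le_rfl),
    supportSeries_ladderSupportBelow_of_succ (w := b) (by omega) (by omega)
      (fun u v => supportSeries_ladderSupport b (by omega) (by omega)) le_rfl le_rfl,
    show b + (c + 2 - (b + 1)) = c + 1 by omega,
    show e + 2 - (c + 2 - (b + 1)) = d + 1 by omega]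
  have hA := one_sub_X_pow_mul_multichooseSeries (e + 1) b 0
  have hB := one_sub_X_pow_mul_multichooseSeries d c 0
  have hC := one_sub_X_pow_mul_multichooseSeries_one c (d + 1)
  have hD := one_sub_X_pow_mul_multichooseSeries_one e b
  simp only [add_zero] at hA hB hC hD
  have hC' : PowerSeries.mk (fun r => (if r = 0 then 0 else
      ((Nat.choose c (r - 1) * Nat.choose (d + 1) r : ℕ) : ℚ))) =
      X * PowerSeries.mk fun r => ((Nat.choose c r * Nat.choose (d + 1) (r + 1) : ℕ) : ℚ) := by
    ext r
    cases r <;> simp [coeff_succ_X_mul]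
  have hexp : 2 * (c + 2 + d + 1) - 3 = (e + 1 + b + 1) + (d + c + 1) := by omega
  have hexp' : (e + 1 + b + 1) + (d + c + 1) = (c + 1 + (d + 1)) + (e + 1 + b) := by omega
  calc _ = PowerSeries.mk (fun r => ((Nat.choose d r * Nat.choose c r : ℕ) : ℚ)) *
        PowerSeries.mk (fun r => ((Nat.choose (e + 1) r * Nat.choose b r : ℕ) : ℚ)) -
        PowerSeries.mk (fun r => (if r = 0 then 0 else
          ((Nat.choose c (r - 1) * Nat.choose (d + 1) r : ℕ) : ℚ))) *
        PowerSeries.mk (fun r => ((Nat.choose e r * Nat.choose b (r + 1) : ℕ) : ℚ)) := by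
        rw [hC', ← hA, ← hB, ← hC, ← hD, hexp, mul_sub]
        congr 1
        · ring
        · rw [hexp']
          ring
    _ = _ := by
        ext k
        rw [map_sub, coeff_mul, coeff_mul, Finset.Nat.sum_antidiagonal_eq_sum_range_succ_mk,
          Finset.Nat.sum_antidiagonal_eq_sum_range_succ_mk, coeff_mk, ← Finset.sum_sub_distrib]
        refine Finset.sum_congr rfl fun r _ => ?_
        simp only [coeff_mk]
        rw [show c + 2 + d + 1 - (c + 2) = d + 1 by omega]
        simp only [Nat.add_sub_cancel]
        rw [show e + 2 - 1 = e + 1 by omega]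
        split_ifs <;> push_cast <;> ring

end LadderSeries

section Rearrangement

variable {p q : ℕ}

theorem sum_Ici_add_sum_fst_lt (f : Fin p × Fin q → ℕ) (c : Fin p × Fin q) :
    ∑ x ∈ Finset.Ici c, f x + ∑ i, (if i < c.1 then ∑ j, f (i, j) else 0) =
      ∑ x, (if x.1 < c.1 ∧ x.2 < c.2 then f x else 0) +
        ∑ j, (if c.2 ≤ j then ∑ i, f (i, j) else 0) := by
  have h1 : ∑ i, (if i < c.1 then ∑ j, f (i, j) else 0) =
      ∑ x : Fin p × Fin q, if x.1 < c.1 then f x else 0 := by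
    rw [Fintype.sum_prod_type]
    refine Finset.sum_congr rfl fun i _ => ?_
    split_ifs <;> simp
  have h2 : ∑ j, (if c.2 ≤ j then ∑ i, f (i, j) else 0) =
      ∑ x : Fin p × Fin q, if c.2 ≤ x.2 then f x else 0 := by
    rw [Fintype.sum_prod_type_right]
    refine Finset.sum_congr rfl fun i _ => ?_
    split_ifs <;> simp
  have h3 : ∑ x ∈ Finset.Ici c, f x = ∑ x, if c ≤ x then f x else 0 := by
    rw [← Finset.sum_filter]
    congr 1
    ext x
    simp
  rw [h1, h2, h3, ← Finset.sum_add_distrib, ← Finset.sum_add_distrib]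
  refine Finset.sum_congr rfl fun x _ => ?_
  simp only [Prod.le_def, Fin.le_def, Fin.lt_def]
  split_ifs <;> omega

/-- Among the matrices with given row and column sums, one whose support contains no strict chain
has the smallest upper-orthant sums. -/
theorem sum_Ici_le_of_antichain {f g : Fin p × Fin q → ℕ}
    (hf : ∀ x y, f x ≠ 0 → f y ≠ 0 → x.1 < y.1 → ¬ x.2 < y.2)
    (hrow : ∀ i, ∑ j, f (i, j) = ∑ j, g (i, j)) (hcol : ∀ j, ∑ i, f (i, j) = ∑ i, g (i, j))
    (c : Fin p × Fin q) : ∑ x ∈ Finset.Ici c, f x ≤ ∑ x ∈ Finset.Ici c, g x := by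
  have h1 := sum_Ici_add_sum_fst_lt f c
  have h2 := sum_Ici_add_sum_fst_lt g c
  simp only [hrow, hcol] at h1
  by_cases hD : ∑ x ∈ Finset.Ici c, f x = 0
  · omega
  · have hE : ∑ x, (if x.1 < c.1 ∧ x.2 < c.2 then f x else 0) = 0 := by
      obtain ⟨y, hy, hfy⟩ := Finset.exists_ne_zero_of_sum_ne_zero hD
      rw [Finset.mem_Ici, Prod.le_def] at hy
      refine Finset.sum_eq_zero fun x _ => ?_
      split_ifs with hx
      · by_contra hfx
        exact hf x y hfx hfy (hx.1.trans_le hy.1) (hx.2.trans_le hy.2)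
      · rfl
    omega

theorem sum_sum_Ici (f : Fin p × Fin q → ℕ) :
    ∑ c, ∑ x ∈ Finset.Ici c, f x = ∑ x, f x * ((x.1 + 1) * (x.2 + 1)) := by
  rw [Finset.sum_comm' (t' := Finset.univ) (s' := fun x => Finset.Iic x) (by simp)]
  refine Finset.sum_congr rfl fun x _ => ?_
  rw [Finset.sum_const, Finset.card_Iic_prod, Fin.card_Iic, Fin.card_Iic, smul_eq_mul, mul_comm]

theorem eq_of_sum_Ici_eq {f g : Fin p × Fin q → ℕ}
    (h : ∀ c, ∑ x ∈ Finset.Ici c, f x = ∑ x ∈ Finset.Ici c, g x) : f = g := by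
  funext c
  induction c using WellFoundedGT.induction with
  | _ c ih =>
    have := h c
    rw [← Finset.Ioi_insert, Finset.sum_insert (by simp), Finset.sum_insert (by simp),
      Finset.sum_congr rfl fun x hx => ih x (Finset.mem_Ioi.mp hx)] at this
    exact Nat.add_right_cancel this

theorem sum_mul_le_of_antichain {f g : Fin p × Fin q → ℕ}
    (hf : ∀ x y, f x ≠ 0 → f y ≠ 0 → x.1 < y.1 → ¬ x.2 < y.2)
    (hrow : ∀ i, ∑ j, f (i, j) = ∑ j, g (i, j)) (hcol : ∀ j, ∑ i, f (i, j) = ∑ i, g (i, j)) :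
    ∑ x, f x * ((x.1 + 1) * (x.2 + 1)) ≤ ∑ x, g x * ((x.1 + 1) * (x.2 + 1)) := by
  rw [← sum_sum_Ici, ← sum_sum_Ici]
  exact Finset.sum_le_sum fun c _ => sum_Ici_le_of_antichain hf hrow hcol c

theorem eq_of_antichain_of_sum_mul_le {f g : Fin p × Fin q → ℕ}
    (hf : ∀ x y, f x ≠ 0 → f y ≠ 0 → x.1 < y.1 → ¬ x.2 < y.2)
    (hrow : ∀ i, ∑ j, f (i, j) = ∑ j, g (i, j)) (hcol : ∀ j, ∑ i, f (i, j) = ∑ i, g (i, j))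
    (hle : ∑ x, g x * ((x.1 + 1) * (x.2 + 1)) ≤ ∑ x, f x * ((x.1 + 1) * (x.2 + 1))) : f = g := by
  have hD := fun c (_ : c ∈ Finset.univ) => sum_Ici_le_of_antichain hf hrow hcol c
  have h := le_antisymm (sum_mul_le_of_antichain hf hrow hcol) hle
  rw [← sum_sum_Ici, ← sum_sum_Ici, Finset.sum_eq_sum_iff_of_le hD] at h
  exact eq_of_sum_Ici_eq fun c => h c (Finset.mem_univ c)

end Rearrangement

section Independence

open MvPolynomial

theorem coeff_mul_ne_zero_iff {τ : Type*} (f g : MvPolynomial τ ℕ) (e : τ →₀ ℕ) :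
    coeff e (f * g) ≠ 0 ↔ ∃ e₁ e₂, e₁ + e₂ = e ∧ coeff e₁ f ≠ 0 ∧ coeff e₂ g ≠ 0 := by
  classical
  rw [coeff_mul, ne_eq, Finset.sum_eq_zero_iff]
  simp only [Finset.HasAntidiagonal.mem_antidiagonal, mul_eq_zero, Prod.forall]
  push Not
  rfl

variable (p q a b : ℕ)

/-- The exponent vector of the monomial `P_{ε,i} Q_{ε,j}`, for a cell `x = (i, j)`. -/
noncomputable def cellExponent (ε : Bool) (x : Fin p × Fin q) : Bool × (Fin p ⊕ Fin q) →₀ ℕ :=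
  Finsupp.single (ε, Sum.inl x.1) 1 + Finsupp.single (ε, Sum.inr x.2) 1

/-- The entries of a generic matrix of rank two which is the sum of a generic matrix of rank one
supported in the columns `< b` and a generic matrix of rank one supported in the rows `≥ a`. -/
noncomputable def genericEntry (R : Type*) [CommSemiring R] (x : Fin p × Fin q) :
    MvPolynomial (Bool × (Fin p ⊕ Fin q)) R :=
  (if (x.2 : ℕ) < b then monomial (cellExponent p q false x) 1 else 0) +
    if a ≤ (x.1 : ℕ) then monomial (cellExponent p q true x) 1 else 0

variable {p q a b}

theorem coeff_genericEntry_ne_zero_iff (x : Fin p × Fin q) (e : Bool × (Fin p ⊕ Fin q) →₀ ℕ) :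
    coeff e (genericEntry p q a b ℕ x) ≠ 0 ↔
      ((x.2 : ℕ) < b ∧ e = cellExponent p q false x) ∨
        (a ≤ (x.1 : ℕ) ∧ e = cellExponent p q true x) := by
  classical
  unfold genericEntry
  split_ifs with h1 h2 h2 <;> simp [h1, h2, coeff_monomial, eq_comm, or_iff_not_imp_left]

theorem map_bind₁_genericEntry (F : Type*) [Field F] (m : Fin p × Fin q →₀ ℕ) :
    bind₁ (genericEntry p q a b F) (monomial m 1) =
      map (Nat.castRingHom F) (bind₁ (genericEntry p q a b ℕ) (monomial m 1)) := by
  rw [map_bind₁, map_monomial, (Nat.castRingHom F).map_one]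
  congr 2
  funext x
  unfold genericEntry
  split_ifs <;> simp

theorem exists_of_coeff_ne_zero (m : Fin p × Fin q →₀ ℕ) (e : Bool × (Fin p ⊕ Fin q) →₀ ℕ)
    (h : coeff e (bind₁ (genericEntry p q a b ℕ) (monomial m 1)) ≠ 0) :
    ∃ m₁ m₂, m₁ + m₂ = m ∧
      e = Finsupp.weight (cellExponent p q false) m₁ +
        Finsupp.weight (cellExponent p q true) m₂ := by
  classical
  induction m using Finsupp.induction_linear generalizing e with
  | zero =>
    refine ⟨0, 0, by simp, ?_⟩
    change coeff e (bind₁ _ 1) ≠ 0 at h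
    simp only [map_one, coeff_one] at h
    simpa [eq_comm] using h
  | add f g hf hg =>
    rw [← one_mul (1 : ℕ), ← monomial_mul, map_mul, coeff_mul_ne_zero_iff] at h
    obtain ⟨e₁, e₂, rfl, h1, h2⟩ := h
    obtain ⟨f₁, f₂, rfl, rfl⟩ := hf e₁ h1
    obtain ⟨g₁, g₂, rfl, rfl⟩ := hg e₂ h2
    refine ⟨f₁ + g₁, f₂ + g₂, by abel, ?_⟩
    simp only [map_add]
    abel
  | single x k =>
    induction k generalizing e with
    | zero =>
      refine ⟨0, 0, by simp, ?_⟩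
      rw [Finsupp.single_zero] at h
      change coeff e (bind₁ _ 1) ≠ 0 at h
      simp only [map_one, coeff_one] at h
      simpa [eq_comm] using h
    | succ k ih =>
      rw [Finsupp.single_add, ← one_mul (1 : ℕ), ← monomial_mul, map_mul,
        coeff_mul_ne_zero_iff] at h
      obtain ⟨e₁, e₂, rfl, h1, h2⟩ := h
      obtain ⟨f₁, f₂, hf, rfl⟩ := ih e₁ h1
      change coeff e₂ (bind₁ _ (X x)) ≠ 0 at h2
      rw [bind₁_X_right, coeff_genericEntry_ne_zero_iff] at h2
      rcases h2 with ⟨-, rfl⟩ | ⟨-, rfl⟩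
      · refine ⟨f₁ + Finsupp.single x 1, f₂, by rw [Finsupp.single_add, ← hf]; abel, ?_⟩
        rw [map_add, Finsupp.weight_single, one_smul]
        abel
      · refine ⟨f₁, f₂ + Finsupp.single x 1, by rw [Finsupp.single_add, ← hf]; abel, ?_⟩
        rw [map_add, Finsupp.weight_single, one_smul]
        abel

theorem coeff_bind₁_ne_zero (ε : Bool) (m : Fin p × Fin q →₀ ℕ)
    (h : ∀ x ∈ m.support, coeff (cellExponent p q ε x) (genericEntry p q a b ℕ x) ≠ 0) :
    coeff (Finsupp.weight (cellExponent p q ε) m)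
      (bind₁ (genericEntry p q a b ℕ) (monomial m 1)) ≠ 0 := by
  classical
  rw [bind₁_monomial, map_one, one_mul, Finsupp.weight_apply, Finsupp.sum]
  have key : ∀ s ⊆ m.support, coeff (∑ x ∈ s, m x • cellExponent p q ε x)
      (∏ x ∈ s, genericEntry p q a b ℕ x ^ m x) ≠ 0 := by
    intro s
    induction s using Finset.induction_on with
    | empty => simp
    | insert x s hx ih =>
      intro hs
      rw [Finset.sum_insert hx, Finset.prod_insert hx, coeff_mul_ne_zero_iff]
      refine ⟨_, _, rfl, ?_, ih ((Finset.subset_insert _ _).trans hs)⟩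
      have hx' := h x (hs (Finset.mem_insert_self _ _))
      induction m x with
      | zero => simp
      | succ k ihk =>
        rw [pow_succ, succ_nsmul, coeff_mul_ne_zero_iff]
        exact ⟨_, _, rfl, ihk, hx'⟩
  exact key _ subset_rfl

theorem weight_cellExponent_inl (ε ε' : Bool) (m : Fin p × Fin q →₀ ℕ) (i : Fin p) :
    Finsupp.weight (cellExponent p q ε) m (ε', Sum.inl i) =
      if ε = ε' then ∑ j, m (i, j) else 0 := by
  classical
  rw [Finsupp.weight_apply, Finsupp.sum_fintype _ _ (by simp), Finsupp.finsetSum_apply,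
    Fintype.sum_prod_type]
  split_ifs with h <;> simp [cellExponent, Finsupp.single_apply, h]

theorem weight_cellExponent_inr (ε ε' : Bool) (m : Fin p × Fin q →₀ ℕ) (j : Fin q) :
    Finsupp.weight (cellExponent p q ε) m (ε', Sum.inr j) =
      if ε = ε' then ∑ i, m (i, j) else 0 := by
  classical
  rw [Finsupp.weight_apply, Finsupp.sum_fintype _ _ (by simp), Finsupp.finsetSum_apply,
    Fintype.sum_prod_type_right]
  split_ifs with h <;> simp [cellExponent, Finsupp.single_apply, h]

end Independence

section LeadingExponent

open MvPolynomial

variable {p q a b : ℕ}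

theorem exists_antichain_add_antichain (m : Fin p × Fin q →₀ ℕ)
    (hm : LadderSupport p q a b 0 p p m.support) :
    ∃ m₁ m₂ : Fin p × Fin q →₀ ℕ, m₁ + m₂ = m ∧
      (∀ x ∈ m₁.support, (x.2 : ℕ) < b) ∧ (∀ x ∈ m₂.support, a ≤ (x.1 : ℕ)) ∧
      (∀ x y, m₁ x ≠ 0 → m₁ y ≠ 0 → x.1 < y.1 → ¬ x.2 < y.2) ∧
      ∀ x y, m₂ x ≠ 0 → m₂ y ≠ 0 → x.1 < y.1 → ¬ x.2 < y.2 := by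
  classical
  obtain ⟨h1, h2, h3⟩ := hm
  refine ⟨m.filter fun y => ¬ (b ≤ (y.2 : ℕ) ∨ ∃ x ∈ m.support, x.1 < y.1 ∧ x.2 < y.2),
    m.filter fun y => b ≤ (y.2 : ℕ) ∨ ∃ x ∈ m.support, x.1 < y.1 ∧ x.2 < y.2, ?_, ?_, ?_, ?_, ?_⟩
  · rw [add_comm, Finsupp.filter_add_filter_not]
  · intro x hx
    rw [Finsupp.support_filter, Finset.mem_filter] at hx
    by_contra hb
    exact hx.2 (Or.inl (not_lt.mp hb))
  · intro y hy
    rw [Finsupp.support_filter, Finset.mem_filter] at hy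
    obtain ⟨hy, hb | ⟨x, hx, hxy, hxy'⟩⟩ := hy
    · have := h1 y hy
      omega
    · exact (h2 x hx y hy hxy hxy').2.2
  · intro x y hx hy hxy hxy'
    rw [← Finsupp.mem_support_iff, Finsupp.support_filter, Finset.mem_filter] at hx hy
    exact hy.2 (Or.inr ⟨x, hx.1, hxy, hxy'⟩)
  · intro x y hx hy hxy hxy'
    rw [← Finsupp.mem_support_iff, Finsupp.support_filter, Finset.mem_filter] at hx hy
    obtain ⟨hx, hb | ⟨z, hz, hzx, hzx'⟩⟩ := hx
    · have := h2 x hx y hy.1 hxy hxy'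
      omega
    · exact h3 z hz x hx y hy.1 hzx hzx' hxy hxy'

theorem exists_leading_exponent (m : Fin p × Fin q →₀ ℕ)
    (hm : LadderSupport p q a b 0 p p m.support) :
    ∃ e, coeff e (bind₁ (genericEntry p q a b ℕ) (monomial m 1)) ≠ 0 ∧
      ∀ m' : Fin p × Fin q →₀ ℕ,
        coeff e (bind₁ (genericEntry p q a b ℕ) (monomial m' 1)) ≠ 0 →
        ∑ x, m' x * ((x.1 + 1) * (x.2 + 1)) ≤ ∑ x, m x * ((x.1 + 1) * (x.2 + 1)) → m' = m := by
  obtain ⟨m₁, m₂, rfl, h1, h2, hc1, hc2⟩ := exists_antichain_add_antichain m hm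
  refine ⟨Finsupp.weight (cellExponent p q false) m₁ + Finsupp.weight (cellExponent p q true) m₂,
    ?_, fun m' hm' hle => ?_⟩
  · rw [← one_mul (1 : ℕ), ← monomial_mul, map_mul, coeff_mul_ne_zero_iff]
    refine ⟨_, _, rfl, coeff_bind₁_ne_zero _ _ fun x hx => ?_,
      coeff_bind₁_ne_zero _ _ fun x hx => ?_⟩ <;> rw [coeff_genericEntry_ne_zero_iff]
    · exact Or.inl ⟨h1 x hx, rfl⟩
    · exact Or.inr ⟨h2 x hx, rfl⟩
  · obtain ⟨n₁, n₂, rfl, he⟩ := exists_of_coeff_ne_zero _ _ hm'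
    have hr := fun ε i => DFunLike.congr_fun he (ε, Sum.inl i)
    have hc := fun ε j => DFunLike.congr_fun he (ε, Sum.inr j)
    simp only [Finsupp.add_apply, weight_cellExponent_inl, weight_cellExponent_inr] at hr hc
    have hr1 : ∀ i, ∑ j, m₁ (i, j) = ∑ j, n₁ (i, j) := fun i => by simpa using hr false i
    have hr2 : ∀ i, ∑ j, m₂ (i, j) = ∑ j, n₂ (i, j) := fun i => by simpa using hr true i
    have hc1' : ∀ j, ∑ i, m₁ (i, j) = ∑ i, n₁ (i, j) := fun j => by simpa using hc false j
    have hc2' : ∀ j, ∑ i, m₂ (i, j) = ∑ i, n₂ (i, j) := fun j => by simpa using hc true j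
    have hle1 := sum_mul_le_of_antichain hc1 hr1 hc1'
    have hle2 := sum_mul_le_of_antichain hc2 hr2 hc2'
    simp only [Finsupp.add_apply, add_mul, Finset.sum_add_distrib] at hle
    rw [DFunLike.coe_injective (eq_of_antichain_of_sum_mul_le hc1 hr1 hc1' (by
        simp only [add_mul] at hle1 hle2 ⊢; omega)),
      DFunLike.coe_injective (eq_of_antichain_of_sum_mul_le hc2 hr2 hc2' (by
        simp only [add_mul] at hle1 hle2 ⊢; omega))]

/-- The monomials with ladder support are linearly independent after the substitution of
`genericEntry`. -/
theorem eq_zero_of_bind₁_genericEntry_eq_zero {F : Type*} [Field F] [CharZero F]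
    (f : MvPolynomial (Fin p × Fin q) F)
    (hstd : ∀ m ∈ f.support, LadderSupport p q a b 0 p p m.support)
    (hf : bind₁ (genericEntry p q a b F) f = 0) : f = 0 := by
  by_contra hne
  obtain ⟨m, hm, hmax⟩ := Finset.exists_max_image f.support
    (fun m => ∑ x, m x * ((x.1 + 1) * (x.2 + 1))) (support_nonempty.mpr hne)
  obtain ⟨e, he, huniq⟩ := exists_leading_exponent m (hstd m hm)
  rw [← support_sum_monomial_coeff f, map_sum] at hf
  have h0 := congrArg (coeff e) hf
  have hterm : ∀ m' : Fin p × Fin q →₀ ℕ,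
      coeff e (bind₁ (genericEntry p q a b F) (monomial m' (coeff m' f))) =
        coeff m' f * (coeff e (bind₁ (genericEntry p q a b ℕ) (monomial m' 1)) : ℕ) := by
    intro m'
    rw [← mul_one (coeff m' f), ← smul_eq_mul, ← smul_monomial, map_smul, coeff_smul,
      map_bind₁_genericEntry, coeff_map, smul_eq_mul, smul_eq_mul, mul_one, eq_natCast]
  rw [coeff_sum, coeff_zero, Finset.sum_eq_single m, hterm] at h0
  · rw [mul_eq_zero, Nat.cast_eq_zero] at h0
    exact h0.elim (mem_support_iff.mp hm) he
  · intro m' hm' hmm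
    rw [hterm, mul_eq_zero, Nat.cast_eq_zero]
    right
    by_contra h
    exact hmm (huniq m' h (hmax m' hm'))
  · exact fun h => absurd hm h

end LeadingExponent

section Straightening

open MvPolynomial

variable {p q a b : ℕ} {F : Type*} [Field F]

theorem exists_eq_add_single {σ : Type*} {m : σ →₀ ℕ} {x : σ} (hx : x ∈ m.support) :
    ∃ n : σ →₀ ℕ, m = n + Finsupp.single x 1 ∧ ∀ y ∈ m.support, y ≠ x → y ∈ n.support := by
  classical
  have hle : Finsupp.single x 1 ≤ m := by
    rw [Finsupp.single_le_iff]
    exact Nat.one_le_iff_ne_zero.mpr (Finsupp.mem_support_iff.mp hx)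
  obtain ⟨n, rfl⟩ := exists_add_of_le hle
  refine ⟨n, add_comm _ _, fun y hy hyx => ?_⟩
  rw [Finsupp.mem_support_iff] at hy ⊢
  simpa [Finsupp.single_apply, hyx.symm] using hy

theorem exists_bad_cells {s : Finset (Fin p × Fin q)} (h : ¬ LadderSupport p q a b 0 p p s) :
    (∃ x ∈ s, (x.1 : ℕ) < a ∧ b ≤ (x.2 : ℕ)) ∨
    (∃ x ∈ s, ∃ y ∈ s, x.1 < y.1 ∧ x.2 < y.2 ∧ (y.1 : ℕ) < a ∧ (y.2 : ℕ) < b) ∨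
    (∃ x ∈ s, ∃ y ∈ s, x.1 < y.1 ∧ x.2 < y.2 ∧ a ≤ (x.1 : ℕ) ∧ b ≤ (x.2 : ℕ)) ∨
    ∃ x ∈ s, ∃ y ∈ s, ∃ z ∈ s, x.1 < y.1 ∧ x.2 < y.2 ∧ y.1 < z.1 ∧ y.2 < z.2 := by
  contrapose! h
  obtain ⟨h1, h2, h3, h4⟩ := h
  refine ⟨fun x hx => ⟨by omega, by omega, h1 x hx, by omega⟩,
    fun x hx y hy hxy hxy' => ⟨by omega, ?_, ?_⟩,
    fun x hx y hy z hz hxy hxy' hyz hyz' => absurd hyz' (h4 x hx y hy z hz hxy hxy' hyz).not_gt⟩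
  · have := h1 x hx
    have := h3 x hx y hy hxy hxy'
    omega
  · have := h1 y hy
    have := h2 x hx y hy hxy hxy'
    omega

/-- The weight of a monomial which the straightening relations decrease. -/
noncomputable def cellWeight (p q : ℕ) : (Fin p × Fin q →₀ ℕ) →+ ℕ :=
  Finsupp.weight fun x => ((x.1 : ℕ) + 1) * ((x.2 : ℕ) + 1)

theorem cellWeight_single (x : Fin p × Fin q) :
    cellWeight p q (Finsupp.single x 1) = ((x.1 : ℕ) + 1) * ((x.2 : ℕ) + 1) := by
  simp [cellWeight, Finsupp.weight_single]

theorem monomial_add_single_one {σ : Type*} (n : σ →₀ ℕ) (x : σ) :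
    (monomial (n + Finsupp.single x 1) 1 : MvPolynomial σ F) = monomial n 1 * X x := by
  rw [X, monomial_mul, one_mul]

variable (p q a b F) in
/-- The span of the monomials of degree `k` with ladder support. -/
noncomputable def ladderSubmodule (k : ℕ) : Submodule F (MvPolynomial (Fin p × Fin q) F) :=
  restrictSupport F {m | m.degree = k ∧ LadderSupport p q a b 0 p p m.support}

theorem mul_add_mul_lt {i i' j j' : ℕ} (hi : i < i') (hj : j < j') :
    (i + 1) * (j' + 1) + (i' + 1) * (j + 1) < (i + 1) * (j + 1) + (i' + 1) * (j' + 1) := by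
  nlinarith [mul_pos (sub_pos.mpr (Int.ofNat_lt.mpr hi)) (sub_pos.mpr (Int.ofNat_lt.mpr hj))]

theorem monomial_mem_of_minor_mem {I : Ideal (MvPolynomial (Fin p × Fin q) F)}
    {N : Submodule F (MvPolynomial (Fin p × Fin q) F)} (hN : I.restrictScalars F ≤ N)
    {i i' : Fin p} {j j' : Fin q} (hi : i < i') (hj : j < j')
    (hI : X (i, j) * X (i', j') - X (i, j') * X (i', j) ∈ I) {m : Fin p × Fin q →₀ ℕ}
    (hx : (i, j) ∈ m.support) (hy : (i', j') ∈ m.support)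
    (ih : ∀ m', cellWeight p q m' < cellWeight p q m → m'.degree = m.degree →
      monomial m' 1 ∈ N) : monomial m 1 ∈ N := by
  obtain ⟨n₁, rfl, hn₁⟩ := exists_eq_add_single hy
  obtain ⟨n, rfl, -⟩ := exists_eq_add_single (hn₁ _ hx fun h => hi.ne (congrArg Prod.fst h))
  have hlt := mul_add_mul_lt (Fin.lt_def.mp hi) (Fin.lt_def.mp hj)
  have hrec := ih (n + Finsupp.single (i, j') 1 + Finsupp.single (i', j) 1)
    (by simp only [map_add, cellWeight_single]; omega)
    (by simp only [map_add, Finsupp.degree_single])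
  simp only [monomial_add_single_one] at hrec ⊢
  have hrel := hN (I.mul_mem_left (monomial n 1) hI)
  convert add_mem hrel hrec using 1
  ring

theorem monomial_mem_of_det_mem {I : Ideal (MvPolynomial (Fin p × Fin q) F)}
    {N : Submodule F (MvPolynomial (Fin p × Fin q) F)} (hN : I.restrictScalars F ≤ N)
    {i₁ i₂ i₃ : Fin p} {j₁ j₂ j₃ : Fin q} (h12 : i₁ < i₂) (h23 : i₂ < i₃) (k12 : j₁ < j₂)
    (k23 : j₂ < j₃)
    (hI : X (i₁, j₁) * X (i₂, j₂) * X (i₃, j₃) + X (i₂, j₁) * X (i₃, j₂) * X (i₁, j₃)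
        + X (i₃, j₁) * X (i₁, j₂) * X (i₂, j₃) - X (i₂, j₁) * X (i₁, j₂) * X (i₃, j₃)
        - X (i₁, j₁) * X (i₃, j₂) * X (i₂, j₃) - X (i₃, j₁) * X (i₂, j₂) * X (i₁, j₃) ∈ I)
    {m : Fin p × Fin q →₀ ℕ} (hx : (i₁, j₁) ∈ m.support) (hy : (i₂, j₂) ∈ m.support)
    (hz : (i₃, j₃) ∈ m.support)
    (ih : ∀ m', cellWeight p q m' < cellWeight p q m → m'.degree = m.degree →
      monomial m' 1 ∈ N) : monomial m 1 ∈ N := by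
  obtain ⟨n₁, rfl, hn₁⟩ := exists_eq_add_single hz
  obtain ⟨n₂, rfl, hn₂⟩ := exists_eq_add_single (hn₁ _ hy fun h => h23.ne (congrArg Prod.fst h))
  obtain ⟨n, rfl, -⟩ := exists_eq_add_single (hn₂ _
    (hn₁ _ hx fun h => (h12.trans h23).ne (congrArg Prod.fst h))
    fun h => h12.ne (congrArg Prod.fst h))
  have w1 := mul_add_mul_lt (Fin.lt_def.mp h12) (Fin.lt_def.mp k12)
  have w2 := mul_add_mul_lt (Fin.lt_def.mp h23) (Fin.lt_def.mp k23)
  have w3 := mul_add_mul_lt (Fin.lt_def.mp (h12.trans h23)) (Fin.lt_def.mp k12)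
  have w4 := mul_add_mul_lt (Fin.lt_def.mp (h12.trans h23)) (Fin.lt_def.mp k23)
  have w5 := mul_add_mul_lt (Fin.lt_def.mp h12) (Fin.lt_def.mp (k12.trans k23))
  have w6 := mul_add_mul_lt (Fin.lt_def.mp h23) (Fin.lt_def.mp (k12.trans k23))
  have w7 := mul_add_mul_lt (Fin.lt_def.mp (h12.trans h23)) (Fin.lt_def.mp (k12.trans k23))
  have hrec : ∀ r₁ r₂ r₃ : Fin p,
      ((r₁ : ℕ) + 1) * (j₁ + 1) + ((r₂ : ℕ) + 1) * (j₂ + 1) + ((r₃ : ℕ) + 1) * (j₃ + 1) <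
        ((i₁ : ℕ) + 1) * (j₁ + 1) + ((i₂ : ℕ) + 1) * (j₂ + 1) + ((i₃ : ℕ) + 1) * (j₃ + 1) →
      monomial n 1 * X (r₁, j₁) * X (r₂, j₂) * X (r₃, j₃) ∈ N := by
    intro r₁ r₂ r₃ hr
    have := ih (n + Finsupp.single (r₁, j₁) 1 + Finsupp.single (r₂, j₂) 1 +
        Finsupp.single (r₃, j₃) 1) (by simp only [map_add, cellWeight_single]; omega)
      (by simp only [map_add, Finsupp.degree_single])
    simpa only [monomial_add_single_one] using this
  have hrel := hN (I.mul_mem_left (monomial n 1) hI)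
  simp only [monomial_add_single_one]
  convert add_mem (add_mem (add_mem (sub_mem (sub_mem hrel
    (hrec i₂ i₃ i₁ (by omega))) (hrec i₃ i₁ i₂ (by omega))) (hrec i₂ i₁ i₃ (by omega)))
    (hrec i₁ i₃ i₂ (by omega))) (hrec i₃ i₂ i₁ (by omega)) using 1
  ring

theorem monomial_mem_ladderSubmodule_sup (I : Ideal (MvPolynomial (Fin p × Fin q) F))
    (hX : ∀ (i : Fin p) (j : Fin q), (i : ℕ) < a → b ≤ (j : ℕ) → X (i, j) ∈ I)
    (hupper : ∀ (i i' : Fin p) (j j' : Fin q), i < i' → (i' : ℕ) < a → j < j' → (j' : ℕ) < b →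
      X (i, j) * X (i', j') - X (i, j') * X (i', j) ∈ I)
    (hlower : ∀ (i i' : Fin p) (j j' : Fin q), a ≤ (i : ℕ) → i < i' → b ≤ (j : ℕ) → j < j' →
      X (i, j) * X (i', j') - X (i, j') * X (i', j) ∈ I)
    (hdet : ∀ (i₁ i₂ i₃ : Fin p) (j₁ j₂ j₃ : Fin q), i₁ < i₂ → i₂ < i₃ → j₁ < j₂ → j₂ < j₃ →
      X (i₁, j₁) * X (i₂, j₂) * X (i₃, j₃) + X (i₂, j₁) * X (i₃, j₂) * X (i₁, j₃)
        + X (i₃, j₁) * X (i₁, j₂) * X (i₂, j₃) - X (i₂, j₁) * X (i₁, j₂) * X (i₃, j₃)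
        - X (i₁, j₁) * X (i₃, j₂) * X (i₂, j₃) - X (i₃, j₁) * X (i₂, j₂) * X (i₁, j₃) ∈ I)
    (m : Fin p × Fin q →₀ ℕ) :
    monomial m 1 ∈ ladderSubmodule p q a b F m.degree ⊔ I.restrictScalars F := by
  induction hω : cellWeight p q m using Nat.strong_induction_on generalizing m with
  | _ ω ih =>
  subst hω
  have hN : I.restrictScalars F ≤ ladderSubmodule p q a b F m.degree ⊔ I.restrictScalars F :=
    le_sup_right
  have ih' : ∀ m', cellWeight p q m' < cellWeight p q m → m'.degree = m.degree →
      monomial m' 1 ∈ ladderSubmodule p q a b F m.degree ⊔ I.restrictScalars F :=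
    fun m' hlt hdeg => hdeg ▸ ih _ hlt m' rfl
  by_cases hstd : LadderSupport p q a b 0 p p m.support
  · refine Submodule.mem_sup_left ?_
    rw [ladderSubmodule, monomial_mem_restrictSupport]
    exact Or.inl ⟨rfl, hstd⟩
  rcases exists_bad_cells hstd with ⟨x, hx, h1, h2⟩ | ⟨x, hx, y, hy, h1, h2, h3, h4⟩ |
    ⟨x, hx, y, hy, h1, h2, h3, h4⟩ | ⟨x, hx, y, hy, z, hz, h1, h2, h3, h4⟩
  · obtain ⟨n, hn, -⟩ := exists_eq_add_single hx
    refine hN ?_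
    rw [hn, monomial_add_single_one]
    exact I.mul_mem_left _ (hX x.1 x.2 h1 h2)
  · exact monomial_mem_of_minor_mem hN h1 h2 (hupper _ _ _ _ h1 h3 h2 h4) hx hy ih'
  · exact monomial_mem_of_minor_mem hN h1 h2 (hlower _ _ _ _ h3 h1 h4 h2) hx hy ih'
  · exact monomial_mem_of_det_mem hN h1 h3 h2 h4 (hdet _ _ _ _ _ _ h1 h3 h2 h4) hx hy hz ih'

end Straightening

section HilbertFunction

open MvPolynomial

theorem genericEntry_eq {p q a b : ℕ} {F : Type*} [Field F] (i : Fin p) (j : Fin q) :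
    genericEntry p q a b F (i, j) =
      X (false, Sum.inl i) * (if (j : ℕ) < b then X (false, Sum.inr j) else 0) +
        (if a ≤ (i : ℕ) then X (true, Sum.inl i) else 0) * X (true, Sum.inr j) := by
  have h : ∀ ε, monomial (cellExponent p q ε (i, j)) (1 : F) =
      X (ε, Sum.inl i) * X (ε, Sum.inr j) := fun ε => by
    rw [X, X, monomial_mul, one_mul, cellExponent]
  unfold genericEntry
  rw [h, h]
  split_ifs <;> simp

variable (F : Type*) [Field F] (n n₁ n₂ : ℕ)

theorem detIdeal_le_ker : detIdeal F n n₁ n₂ ≤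
    RingHom.ker (bind₁ (genericEntry (n - n₁) n₂ (n₂ - n₁) n₁ F)) := by
  rw [detIdeal, Ideal.span_le]
  rintro f (((⟨i, j, hi, hj, rfl⟩ | ⟨i, i', j, j', hi, hi', hj, hj', rfl⟩) |
    ⟨i, i', j, j', hi, hi', hj, hj', rfl⟩) | ⟨i₁, i₂, i₃, j₁, j₂, j₃, -, -, -, -, rfl⟩) <;>
    rw [SetLike.mem_coe, RingHom.mem_ker] <;>
    simp only [map_sub, map_add, map_mul, bind₁_X_right, genericEntry_eq]
  · rw [if_neg hj.not_gt, if_neg hi.not_ge]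
    simp
  · have h : ¬ n₂ - n₁ ≤ (i : ℕ) := by omega
    rw [if_neg h, if_neg hi'.not_ge]
    ring
  · have h : ¬ (j' : ℕ) < n₁ := by omega
    rw [if_neg h, if_neg hj.not_gt]
    ring
  · ring

theorem homogeneousSubmodule_le_sup_detIdeal (k : ℕ) :
    homogeneousSubmodule (Fin (n - n₁) × Fin n₂) F k ≤
      ladderSubmodule (n - n₁) n₂ (n₂ - n₁) n₁ F k ⊔ (detIdeal F n n₁ n₂).restrictScalars F := by
  intro f hf
  rw [← support_sum_monomial_coeff f]
  refine Submodule.sum_mem _ fun m hm => ?_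
  rw [← mul_one (coeff m f), ← smul_eq_mul, ← smul_monomial]
  refine Submodule.smul_mem _ _ ?_
  rw [homogeneousSubmodule_eq_finsupp_supported] at hf
  rw [← show m.degree = k from hf hm]
  refine monomial_mem_ladderSubmodule_sup _ (fun i j hi hj => Ideal.subset_span ?_)
    (fun i i' j j' hi hi' hj hj' => Ideal.subset_span ?_)
    (fun i i' j j' hi hi' hj hj' => Ideal.subset_span ?_)
    (fun i₁ i₂ i₃ j₁ j₂ j₃ h1 h2 h3 h4 => Ideal.subset_span ?_) m
  · exact Or.inl (Or.inl (Or.inl ⟨i, j, hi, hj, rfl⟩))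
  · exact Or.inl (Or.inl (Or.inr ⟨i, i', j, j', hi, hi', hj, hj', rfl⟩))
  · exact Or.inl (Or.inr ⟨i, i', j, j', hi, hi', hj, hj', rfl⟩)
  · exact Or.inr ⟨i₁, i₂, i₃, j₁, j₂, j₃, h1, h2, h3, h4, rfl⟩

theorem ladderSubmodule_inf_detIdeal [CharZero F] (k : ℕ)
    (f : MvPolynomial (Fin (n - n₁) × Fin n₂) F)
    (hf : f ∈ ladderSubmodule (n - n₁) n₂ (n₂ - n₁) n₁ F k) (hI : f ∈ detIdeal F n n₁ n₂) :
    f = 0 :=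
  eq_zero_of_bind₁_genericEntry_eq_zero f (fun _ hm => (hf hm).2) (detIdeal_le_ker F n n₁ n₂ hI)

open Classical in
theorem hilbFn_eq_card [CharZero F] (k : ℕ) :
    hilbFn F n n₁ n₂ k = ((Finset.univ.finsuppAntidiag k).filter
      fun m : Fin (n - n₁) × Fin n₂ →₀ ℕ =>
        LadderSupport (n - n₁) n₂ (n₂ - n₁) n₁ 0 (n - n₁) (n - n₁) m.support).card := by
  set H := homogeneousSubmodule (Fin (n - n₁) × Fin n₂) F k with hH
  set L := ladderSubmodule (n - n₁) n₂ (n₂ - n₁) n₁ F k with hL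
  set J := Submodule.comap H.subtype ((detIdeal F n n₁ n₂).restrictScalars F)
  have hLH : L ≤ H := by
    rw [hH, homogeneousSubmodule_eq_finsupp_supported]
    exact fun f hf m hm => (hf hm).1
  have hbij : Function.Bijective (J.mkQ ∘ₗ Submodule.inclusion hLH) := by
    constructor
    · rw [← LinearMap.ker_eq_bot, LinearMap.ker_eq_bot']
      rintro ⟨f, hf⟩ h0
      rw [LinearMap.comp_apply, Submodule.mkQ_apply, Submodule.Quotient.mk_eq_zero] at h0
      exact Subtype.ext (ladderSubmodule_inf_detIdeal F n n₁ n₂ k f hf h0)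
    · intro y
      obtain ⟨⟨f, hf⟩, rfl⟩ := J.mkQ_surjective y
      obtain ⟨l, hl, g, hg, hlg⟩ :=
        Submodule.mem_sup.mp (homogeneousSubmodule_le_sup_detIdeal F n n₁ n₂ k hf)
      refine ⟨⟨l, hl⟩, ?_⟩
      rw [LinearMap.comp_apply, Submodule.mkQ_apply, Submodule.mkQ_apply, Submodule.Quotient.eq]
      change l - f ∈ (detIdeal F n n₁ n₂).restrictScalars F
      rw [← hlg, sub_add_cancel_left]
      exact neg_mem hg
  change Module.finrank F (H ⧸ J) = _
  rw [← (LinearEquiv.ofBijective _ hbij).finrank_eq, hL, ladderSubmodule,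
    Module.finrank_eq_nat_card_basis (basisRestrictSupport F _), Nat.card_coe_set_eq,
    ← Set.ncard_coe_finset]
  congr 1
  ext m
  simp [Finset.mem_finsuppAntidiag, Finsupp.degree_eq_sum]

end HilbertFunction

/-- Theorem 1 of the paper (case `n₁ ≤ n₂ < n`): the Hilbert series of the associated
variety of `H_{⟨ℓ₁,ℓ₂⟩}`, as an identity in `ℚ⟦t⟧`. -/
theorem hilbSeries_eq {F : Type*} [Field F] [CharZero F] (n n₁ n₂ : ℕ)
    (h1 : 1 ≤ n₁) (h2 : n₁ ≤ n₂) (h3 : n₂ < n) (h4 : 2 ≤ n₂) (h5 : n₁ ≤ n - 2) :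
    (1 - PowerSeries.X : PowerSeries ℚ) ^ (2 * n - 3) *
        PowerSeries.mk (fun k => (hilbFn F n n₁ n₂ k : ℚ)) =
      PowerSeries.mk (fun k => ∑ r ∈ Finset.range (k + 1),
        (((Nat.choose (n₂ - 2) r * Nat.choose (n - n₂ - 1) r *
            Nat.choose (n₁ - 1) (k - r) * Nat.choose (n - n₁ - 1) (k - r) : ℕ) : ℚ) -
          (if r = 0 then 0 else
            ((Nat.choose (n₂ - 2) (r - 1) * Nat.choose (n - n₂) r *
              Nat.choose (n₁ - 1) (k - r + 1) * Nat.choose (n - n₁ - 2) (k - r) : ℕ) : ℚ)))) := by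
  classical
  rw [← one_sub_X_pow_mul_supportSeries_ladderSupport n n₁ n₂ h1 h2 h3 h4 h5, supportSeries]
  congr 2
  funext k
  rw [hilbFn_eq_card]
end
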